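/- arXiv:2402.00796 — 8 statements merged into one kernel-verified Lean document; each statement's English description precedes it below -/
import Mathlib

section
/- Let 0 ≤ e < 1/√2, b = √(1 − e²), and let ∂D = {(x, y) ∈ ℝ² : x² + y²/b² = 1} be the boundary of the elliptic domain with semimajor axis 1 and eccentricity e centered at the origin. Then for every μ > 0 and every E > 0, every Keplerian arc of energy E and mass parameter μ intersects ∂D in at most two points; that is, the set {z(t) : t ∈ J} ∩ ∂D contains at most two elements. -/
/-- A strict form of the power mean inequality for fourth powers. -/
theorem add_mul_pow_four_lt {α β s t : ℝ} (hα : 0 < α) (hβ : 0 < β) (hst : s ≠ t) :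
    (α * s + β * t) ^ 4 < (α + β) ^ 3 * (α * s ^ 4 + β * t ^ 4) := by
  have hab : 0 < α * β := mul_pos hα hβ
  have h1 : (α * s + β * t) ^ 2 < (α + β) * (α * s ^ 2 + β * t ^ 2) := by
    have : 0 < α * β * (s - t) ^ 2 := mul_pos hab (by positivity [sub_ne_zero.2 hst])
    nlinarith
  have h2 : (α * s ^ 2 + β * t ^ 2) ^ 2 ≤ (α + β) * (α * s ^ 4 + β * t ^ 4) := by
    have : 0 ≤ α * β * (s ^ 2 - t ^ 2) ^ 2 := by positivity
    nlinarith
  calc (α * s + β * t) ^ 4 = ((α * s + β * t) ^ 2) ^ 2 := by ring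
    _ < ((α + β) * (α * s ^ 2 + β * t ^ 2)) ^ 2 := by
      apply pow_lt_pow_left₀ h1 (sq_nonneg _) two_ne_zero
    _ = (α + β) ^ 2 * (α * s ^ 2 + β * t ^ 2) ^ 2 := by ring
    _ ≤ (α + β) ^ 2 * ((α + β) * (α * s ^ 4 + β * t ^ 4)) := by gcongr
    _ = _ := by ring

theorem add_mul_pow_four_le {α β : ℝ} (hα : 0 < α) (hβ : 0 < β) (s t : ℝ) :
    (α * s + β * t) ^ 4 ≤ (α + β) ^ 3 * (α * s ^ 4 + β * t ^ 4) := by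
  by_cases h : s = t
  · subst h
    exact le_of_eq (by ring)
  · exact (add_mul_pow_four_lt hα hβ h).le

/-- The unit ball of the quartic form `x⁴ + c x² y² + y⁴` is strictly convex for `0 ≤ c < 6`. -/
theorem quartic_form_lt_one {c α β x₁ y₁ x₂ y₂ : ℝ} (hc0 : 0 ≤ c) (hc6 : c < 6)
    (hα : 0 < α) (hβ : 0 < β) (hαβ : α + β ≤ 1)
    (h₁ : x₁ ^ 4 + c * x₁ ^ 2 * y₁ ^ 2 + y₁ ^ 4 = 1)
    (h₂ : x₂ ^ 4 + c * x₂ ^ 2 * y₂ ^ 2 + y₂ ^ 4 = 1)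
    (hne : x₁ ≠ x₂ ∨ y₁ ≠ y₂) :
    (α * x₁ + β * x₂) ^ 4 + c * (α * x₁ + β * x₂) ^ 2 * (α * y₁ + β * y₂) ^ 2
      + (α * y₁ + β * y₂) ^ 4 < 1 := by
  have hsum : (α * x₁ + β * x₂) ^ 4 + (α * y₁ + β * y₂) ^ 4 <
      (α + β) ^ 3 * (α * x₁ ^ 4 + β * x₂ ^ 4) + (α + β) ^ 3 * (α * y₁ ^ 4 + β * y₂ ^ 4) := by
    rcases hne with h | h
    · exact add_lt_add_of_lt_of_le (add_mul_pow_four_lt hα hβ h) (add_mul_pow_four_le hα hβ _ _)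
    · exact add_lt_add_of_le_of_lt (add_mul_pow_four_le hα hβ _ _) (add_mul_pow_four_lt hα hβ h)
  have hp := add_mul_pow_four_le hα hβ (x₁ + y₁) (x₂ + y₂)
  have hm := add_mul_pow_four_le hα hβ (x₁ - y₁) (x₂ - y₂)
  have k₁ := mul_lt_mul_of_pos_left hsum (sub_pos.2 hc6)
  have k₂ := mul_le_mul_of_nonneg_left (add_le_add hp hm) hc0
  have hone : (α + β) ^ 4 ≤ 1 := pow_le_one₀ (by positivity) hαβ
  have e : (α + β) ^ 3 * (α * (x₁ ^ 4 + c * x₁ ^ 2 * y₁ ^ 2 + y₁ ^ 4)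
      + β * (x₂ ^ 4 + c * x₂ ^ 2 * y₂ ^ 2 + y₂ ^ 4)) = (α + β) ^ 4 := by
    rw [h₁, h₂]; ring
  linarith

/-- Two points on the same branch of a centered hyperbola and on the boundary of the strictly
convex quartic oval: no third common point lies in the open cone they span. -/
theorem no_common_point_between {c α β k l m P x₁ y₁ x₂ y₂ x₃ y₃ : ℝ}
    (hc0 : 0 ≤ c) (hc6 : c < 6) (hα : 0 < α) (hβ : 0 < β) (hP : 0 < P)
    (h₁ : x₁ ^ 4 + c * x₁ ^ 2 * y₁ ^ 2 + y₁ ^ 4 = 1)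
    (h₂ : x₂ ^ 4 + c * x₂ ^ 2 * y₂ ^ 2 + y₂ ^ 4 = 1)
    (h₃ : x₃ ^ 4 + c * x₃ ^ 2 * y₃ ^ 2 + y₃ ^ 4 = 1)
    (q₁ : k * x₁ ^ 2 + 2 * l * x₁ * y₁ + m * y₁ ^ 2 = P)
    (q₂ : k * x₂ ^ 2 + 2 * l * x₂ * y₂ + m * y₂ ^ 2 = P)
    (q₃ : k * x₃ ^ 2 + 2 * l * x₃ * y₃ + m * y₃ ^ 2 = P)
    (hB : P ≤ k * x₁ * x₂ + l * (x₁ * y₂ + x₂ * y₁) + m * y₁ * y₂)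
    (hne : x₁ ≠ x₂ ∨ y₁ ≠ y₂)
    (hx : x₃ = α * x₁ + β * x₂) (hy : y₃ = α * y₁ + β * y₂) : False := by
  have hαβ : α + β ≤ 1 := by
    have hQ : α ^ 2 * P + β ^ 2 * P
        + 2 * (α * β) * (k * x₁ * x₂ + l * (x₁ * y₂ + x₂ * y₁) + m * y₁ * y₂) = P := by
      subst hx hy
      linear_combination q₃ - α ^ 2 * q₁ - β ^ 2 * q₂
    have hB' := mul_le_mul_of_nonneg_left hB (mul_pos hα hβ).le
    have : (α + β) ^ 2 * P ≤ 1 * P := by linarith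
    have := le_of_mul_le_mul_right this hP
    nlinarith
  have := quartic_form_lt_one hc0 hc6 hα hβ hαβ h₁ h₂ hne
  rw [← hx, ← hy, h₃] at this
  exact lt_irrefl _ this

/-- Reverse Cauchy-Schwarz inequality for an indefinite binary quadratic form. -/
theorem sq_le_sq_bilin {k l m P x₁ y₁ x₂ y₂ : ℝ} (hdet : k * m - l ^ 2 < 0)
    (q₁ : k * x₁ ^ 2 + 2 * l * x₁ * y₁ + m * y₁ ^ 2 = P)
    (q₂ : k * x₂ ^ 2 + 2 * l * x₂ * y₂ + m * y₂ ^ 2 = P) :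
    P ^ 2 ≤ (k * x₁ * x₂ + l * (x₁ * y₂ + x₂ * y₁) + m * y₁ * y₂) ^ 2 := by
  have h := mul_nonneg (sub_nonneg.2 hdet.le) (sq_nonneg (x₁ * y₂ - x₂ * y₁))
  have e : P ^ 2 = (k * x₁ ^ 2 + 2 * l * x₁ * y₁ + m * y₁ ^ 2)
      * (k * x₂ ^ 2 + 2 * l * x₂ * y₂ + m * y₂ ^ 2) := by rw [q₁, q₂, sq]
  rw [e]
  linarith

theorem exists_sign_bilin {k l m P x₁ y₁ x₂ y₂ : ℝ} (hP : 0 < P) (hdet : k * m - l ^ 2 < 0)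
    (q₁ : k * x₁ ^ 2 + 2 * l * x₁ * y₁ + m * y₁ ^ 2 = P)
    (q₂ : k * x₂ ^ 2 + 2 * l * x₂ * y₂ + m * y₂ ^ 2 = P) :
    ∃ s : ℝ, s ^ 2 = 1 ∧
      P ≤ k * x₁ * (s * x₂) + l * (x₁ * (s * y₂) + s * x₂ * y₁) + m * y₁ * (s * y₂) := by
  have h := sq_le_sq.1 (sq_le_sq_bilin hdet q₁ q₂)
  rw [abs_of_pos hP] at h
  rcases le_abs.1 h with h | h
  · exact ⟨1, by norm_num, by linarith⟩
  · exact ⟨-1, by norm_num, by linarith⟩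

theorem no_positive_relation {c k l m P x₁ y₁ x₂ y₂ x₃ y₃ a₁ a₂ a₃ : ℝ}
    (hc0 : 0 ≤ c) (hc6 : c < 6) (hP : 0 < P)
    (h₁ : x₁ ^ 4 + c * x₁ ^ 2 * y₁ ^ 2 + y₁ ^ 4 = 1)
    (h₂ : x₂ ^ 4 + c * x₂ ^ 2 * y₂ ^ 2 + y₂ ^ 4 = 1)
    (h₃ : x₃ ^ 4 + c * x₃ ^ 2 * y₃ ^ 2 + y₃ ^ 4 = 1)
    (q₁ : k * x₁ ^ 2 + 2 * l * x₁ * y₁ + m * y₁ ^ 2 = P)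
    (q₂ : k * x₂ ^ 2 + 2 * l * x₂ * y₂ + m * y₂ ^ 2 = P)
    (q₃ : k * x₃ ^ 2 + 2 * l * x₃ * y₃ + m * y₃ ^ 2 = P)
    (hB : P ≤ k * x₁ * x₂ + l * (x₁ * y₂ + x₂ * y₁) + m * y₁ * y₂)
    (hne : x₁ * y₂ - x₂ * y₁ ≠ 0)
    (ha₁ : a₁ * a₃ < 0) (ha₂ : a₂ * a₃ < 0)
    (hx : a₁ * x₁ + a₂ * x₂ + a₃ * x₃ = 0) (hy : a₁ * y₁ + a₂ * y₂ + a₃ * y₃ = 0) : False := by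
  have ha : a₃ ≠ 0 := by
    rintro rfl
    simp at ha₁
  have hpos : ∀ a : ℝ, a * a₃ < 0 → 0 < -a / a₃ := fun a h => by
    have e : -a / a₃ = -(a * a₃) / a₃ ^ 2 := by field_simp
    rw [e]
    exact div_pos (neg_pos.2 h) (by positivity)
  refine no_common_point_between hc0 hc6 (hpos a₁ ha₁) (hpos a₂ ha₂) hP h₁ h₂ h₃ q₁ q₂ q₃ hB ?_
    ?_ ?_
  · by_contra! h
    exact hne (by rw [h.1, h.2]; ring)
  · field_simp
    linarith
  · field_simp
    linarith

theorem no_three_points_on_branch {c k l m P x₁ y₁ x₂ y₂ x₃ y₃ : ℝ}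
    (hc0 : 0 ≤ c) (hc6 : c < 6) (hP : 0 < P) (hdet : k * m - l ^ 2 < 0)
    (h₁ : x₁ ^ 4 + c * x₁ ^ 2 * y₁ ^ 2 + y₁ ^ 4 = 1)
    (h₂ : x₂ ^ 4 + c * x₂ ^ 2 * y₂ ^ 2 + y₂ ^ 4 = 1)
    (h₃ : x₃ ^ 4 + c * x₃ ^ 2 * y₃ ^ 2 + y₃ ^ 4 = 1)
    (q₁ : k * x₁ ^ 2 + 2 * l * x₁ * y₁ + m * y₁ ^ 2 = P)
    (q₂ : k * x₂ ^ 2 + 2 * l * x₂ * y₂ + m * y₂ ^ 2 = P)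
    (q₃ : k * x₃ ^ 2 + 2 * l * x₃ * y₃ + m * y₃ ^ 2 = P)
    (hB₁₂ : P ≤ k * x₁ * x₂ + l * (x₁ * y₂ + x₂ * y₁) + m * y₁ * y₂)
    (hB₁₃ : P ≤ k * x₁ * x₃ + l * (x₁ * y₃ + x₃ * y₁) + m * y₁ * y₃)
    (hne₁₂ : x₁ * y₂ - x₂ * y₁ ≠ 0) (hne₁₃ : x₁ * y₃ - x₃ * y₁ ≠ 0)
    (hne₂₃ : x₂ * y₃ - x₃ * y₂ ≠ 0) : False := by
  have hB₂₃ : P ≤ k * x₂ * x₃ + l * (x₂ * y₃ + x₃ * y₂) + m * y₂ * y₃ := by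
    have h := sq_le_sq.1 (sq_le_sq_bilin hdet q₂ q₃)
    rw [abs_of_pos hP] at h
    rcases le_abs.1 h with h | h
    · exact h
    exfalso
    set B₁₂ := k * x₁ * x₂ + l * (x₁ * y₂ + x₂ * y₁) + m * y₁ * y₂ with e₁₂
    set B₁₃ := k * x₁ * x₃ + l * (x₁ * y₃ + x₃ * y₁) + m * y₁ * y₃ with e₁₃
    set B₂₃ := k * x₂ * x₃ + l * (x₂ * y₃ + x₃ * y₂) + m * y₂ * y₃ with e₂₃
    set C₁₂ := x₁ * y₂ - x₂ * y₁ with f₁₂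
    set C₁₃ := x₁ * y₃ - x₃ * y₁ with f₁₃
    have i₁ : P * B₂₃ = B₁₂ * B₁₃ + (k * m - l ^ 2) * (C₁₂ * C₁₃) := by
      rw [← q₁]; ring
    have i₂ : B₁₂ ^ 2 = P ^ 2 + (l ^ 2 - k * m) * C₁₂ ^ 2 := by
      have : P ^ 2 = (k * x₁ ^ 2 + 2 * l * x₁ * y₁ + m * y₁ ^ 2)
        * (k * x₂ ^ 2 + 2 * l * x₂ * y₂ + m * y₂ ^ 2) := by rw [q₁, q₂, sq]
      rw [this]; ring
    have i₃ : B₁₃ ^ 2 = P ^ 2 + (l ^ 2 - k * m) * C₁₃ ^ 2 := by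
      have : P ^ 2 = (k * x₁ ^ 2 + 2 * l * x₁ * y₁ + m * y₁ ^ 2)
        * (k * x₃ ^ 2 + 2 * l * x₃ * y₃ + m * y₃ ^ 2) := by rw [q₁, q₃, sq]
      rw [this]; ring
    clear_value B₁₂ B₁₃ B₂₃ C₁₂ C₁₃
    have hd : 0 < l ^ 2 - k * m := by linarith
    have j₁ : P * B₂₃ < 0 := mul_neg_of_pos_of_neg hP (by linarith)
    have j₂ : B₁₂ * B₁₃ < (l ^ 2 - k * m) * (C₁₂ * C₁₃) := by linarith
    have j₃ : (B₁₂ * B₁₃) ^ 2 < ((l ^ 2 - k * m) * (C₁₂ * C₁₃)) ^ 2 :=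
      pow_lt_pow_left₀ j₂ (mul_nonneg (by linarith) (by linarith)) two_ne_zero
    rw [mul_pow, i₂, i₃] at j₃
    have : 0 < P ^ 4 + P ^ 2 * ((l ^ 2 - k * m) * (C₁₂ ^ 2 + C₁₃ ^ 2)) := by positivity
    linarith
  have hx : (x₂ * y₃ - x₃ * y₂) * x₁ + -(x₁ * y₃ - x₃ * y₁) * x₂ + (x₁ * y₂ - x₂ * y₁) * x₃
      = 0 := by ring
  have hy : (x₂ * y₃ - x₃ * y₂) * y₁ + -(x₁ * y₃ - x₃ * y₁) * y₂ + (x₁ * y₂ - x₂ * y₁) * y₃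
      = 0 := by ring
  have hne₃₂ : x₃ * y₂ - x₂ * y₃ ≠ 0 := fun h => hne₂₃ (by linarith)
  have hB₃₂ : P ≤ k * x₃ * x₂ + l * (x₃ * y₂ + x₂ * y₃) + m * y₃ * y₂ := by linarith
  have hne₁₃' := neg_ne_zero.2 hne₁₃
  have hrel : (x₂ * y₃ - x₃ * y₂) * P
      + -(x₁ * y₃ - x₃ * y₁) * (k * x₁ * x₂ + l * (x₁ * y₂ + x₂ * y₁) + m * y₁ * y₂)
      + (x₁ * y₂ - x₂ * y₁) * (k * x₁ * x₃ + l * (x₁ * y₃ + x₃ * y₁) + m * y₁ * y₃) = 0 := by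
    rw [← q₁]; ring
  generalize x₂ * y₃ - x₃ * y₂ = a₁ at *
  generalize -(x₁ * y₃ - x₃ * y₁) = a₂ at *
  generalize ha₃ : x₁ * y₂ - x₂ * y₁ = a₃ at *
  have key₃ : a₁ * a₃ < 0 → a₂ * a₃ < 0 → False := fun u v =>
    no_positive_relation hc0 hc6 hP h₁ h₂ h₃ q₁ q₂ q₃ hB₁₂ (ha₃ ▸ hne₁₂) u v hx hy
  have key₂ : a₁ * a₂ < 0 → a₃ * a₂ < 0 → False := fun u v =>
    no_positive_relation hc0 hc6 hP h₁ h₃ h₂ q₁ q₃ q₂ hB₁₃ hne₁₃ u v (by linarith) (by linarith)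
  have key₁ : a₃ * a₁ < 0 → a₂ * a₁ < 0 → False := fun u v =>
    no_positive_relation hc0 hc6 hP h₃ h₂ h₁ q₃ q₂ q₁ hB₃₂ hne₃₂ u v (by linarith) (by linarith)
  rcases lt_or_gt_of_ne hne₂₃ with s₁ | s₁ <;> rcases lt_or_gt_of_ne hne₁₃' with s₂ | s₂ <;>
    rcases lt_or_gt_of_ne hne₁₂ with s₃ | s₃
  · have := mul_neg_of_neg_of_pos s₁ hP
    have := mul_neg_of_neg_of_pos s₂ (hP.trans_le hB₁₂)
    have := mul_neg_of_neg_of_pos s₃ (hP.trans_le hB₁₃)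
    linarith
  · exact key₃ (mul_neg_of_neg_of_pos s₁ s₃) (mul_neg_of_neg_of_pos s₂ s₃)
  · exact key₂ (mul_neg_of_neg_of_pos s₁ s₂) (mul_neg_of_neg_of_pos s₃ s₂)
  · exact key₁ (mul_neg_of_pos_of_neg s₃ s₁) (mul_neg_of_pos_of_neg s₂ s₁)
  · exact key₁ (mul_neg_of_neg_of_pos s₃ s₁) (mul_neg_of_neg_of_pos s₂ s₁)
  · exact key₂ (mul_neg_of_pos_of_neg s₁ s₂) (mul_neg_of_pos_of_neg s₃ s₂)
  · exact key₃ (mul_neg_of_pos_of_neg s₁ s₃) (mul_neg_of_pos_of_neg s₂ s₃)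
  · have := mul_pos s₁ hP
    have := mul_pos s₂ (hP.trans_le hB₁₂)
    have := mul_pos s₃ (hP.trans_le hB₁₃)
    linarith

/-- A hyperbola centered at the origin meets the quartic oval in at most two pairs of
antipodal points. -/
theorem no_three_points_on_hyperbola {c k l m P x₁ y₁ x₂ y₂ x₃ y₃ : ℝ}
    (hc0 : 0 ≤ c) (hc6 : c < 6) (hP : 0 < P) (hdet : k * m - l ^ 2 < 0)
    (h₁ : x₁ ^ 4 + c * x₁ ^ 2 * y₁ ^ 2 + y₁ ^ 4 = 1)
    (h₂ : x₂ ^ 4 + c * x₂ ^ 2 * y₂ ^ 2 + y₂ ^ 4 = 1)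
    (h₃ : x₃ ^ 4 + c * x₃ ^ 2 * y₃ ^ 2 + y₃ ^ 4 = 1)
    (q₁ : k * x₁ ^ 2 + 2 * l * x₁ * y₁ + m * y₁ ^ 2 = P)
    (q₂ : k * x₂ ^ 2 + 2 * l * x₂ * y₂ + m * y₂ ^ 2 = P)
    (q₃ : k * x₃ ^ 2 + 2 * l * x₃ * y₃ + m * y₃ ^ 2 = P)
    (hne₁₂ : x₁ * y₂ - x₂ * y₁ ≠ 0) (hne₁₃ : x₁ * y₃ - x₃ * y₁ ≠ 0)
    (hne₂₃ : x₂ * y₃ - x₃ * y₂ ≠ 0) : False := by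
  obtain ⟨s, hs, hBs⟩ := exists_sign_bilin hP hdet q₁ q₂
  obtain ⟨t, ht, hBt⟩ := exists_sign_bilin hP hdet q₁ q₃
  have hs0 : s ≠ 0 := by rintro rfl; norm_num at hs
  have ht0 : t ≠ 0 := by rintro rfl; norm_num at ht
  have hs4 : s ^ 4 = 1 := by linear_combination (s ^ 2 + 1) * hs
  have ht4 : t ^ 4 = 1 := by linear_combination (t ^ 2 + 1) * ht
  refine no_three_points_on_branch hc0 hc6 hP hdet h₁
    (x₂ := s * x₂) (y₂ := s * y₂) (x₃ := t * x₃) (y₃ := t * y₃)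
    (by linear_combination s ^ 4 * h₂ + hs4) (by linear_combination t ^ 4 * h₃ + ht4) q₁
    (by linear_combination s ^ 2 * q₂ + P * hs) (by linear_combination t ^ 2 * q₃ + P * ht)
    hBs hBt ?_ ?_ ?_
  · exact fun h => mul_ne_zero hs0 hne₁₂ (by linear_combination h)
  · exact fun h => mul_ne_zero ht0 hne₁₃ (by linear_combination h)
  · exact fun h => mul_ne_zero (mul_ne_zero hs0 ht0) hne₂₃ (by linear_combination h)

theorem cross_ne_zero {k l m P x₁ y₁ x₂ y₂ : ℝ} (hP : P ≠ 0)
    (q₁ : k * x₁ ^ 2 + 2 * l * x₁ * y₁ + m * y₁ ^ 2 = P)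
    (q₂ : k * x₂ ^ 2 + 2 * l * x₂ * y₂ + m * y₂ ^ 2 = P)
    (hne : ¬(x₁ ^ 2 - y₁ ^ 2 = x₂ ^ 2 - y₂ ^ 2 ∧ 2 * x₁ * y₁ = 2 * x₂ * y₂)) :
    x₁ * y₂ - x₂ * y₁ ≠ 0 := by
  intro h
  have hx : x₁ ^ 2 = x₂ ^ 2 := mul_right_cancel₀ hP (by
    linear_combination x₂ ^ 2 * q₁ - x₁ ^ 2 * q₂
      + (2 * l * x₁ * x₂ + m * (x₁ * y₂ + x₂ * y₁)) * h)
  have hy : y₁ ^ 2 = y₂ ^ 2 := mul_right_cancel₀ hP (by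
    linear_combination y₂ ^ 2 * q₁ - y₁ ^ 2 * q₂
      - (2 * l * y₁ * y₂ + k * (x₁ * y₂ + x₂ * y₁)) * h)
  have hxy : x₁ * y₁ = x₂ * y₂ := mul_right_cancel₀ hP (by
    linear_combination x₂ * y₂ * q₁ - x₁ * y₁ * q₂ + (m * y₁ * y₂ - k * x₁ * x₂) * h)
  exact hne ⟨by linarith, by linarith⟩

/-- Levi-Civita coordinates: complex square roots in real form. -/
theorem exists_levi_civita {X Y r : ℝ} (hr : 0 ≤ r) (hXY : X ^ 2 + Y ^ 2 = r ^ 2) :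
    ∃ x y : ℝ, x ^ 2 - y ^ 2 = X ∧ 2 * x * y = Y ∧ x ^ 2 + y ^ 2 = r := by
  obtain ⟨w, hw⟩ := IsAlgClosed.exists_pow_nat_eq (⟨X, Y⟩ : ℂ) two_pos
  have hre := congrArg Complex.re hw
  have him := congrArg Complex.im hw
  simp only [sq, Complex.mul_re, Complex.mul_im] at hre him
  refine ⟨w.re, w.im, by linarith, by linarith, ?_⟩
  rw [← sq_eq_sq₀ (by positivity) hr, ← hXY, ← hre, ← him]
  ring

/-- A branch of a hyperbola with focus at the origin, in focal form, has at most two points on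
the centered ellipse `x² + d y² = 1` with `1 ≤ d < 2`. -/
theorem focal_hyperbola_meets_ellipse {d μ A B P X₁ Y₁ r₁ X₂ Y₂ r₂ X₃ Y₃ r₃ : ℝ}
    (hd1 : 1 ≤ d) (hd2 : d < 2) (hP : 0 < P) (hAB : μ ^ 2 < A ^ 2 + B ^ 2)
    (hr₁ : 0 ≤ r₁) (hr₂ : 0 ≤ r₂) (hr₃ : 0 ≤ r₃)
    (n₁ : X₁ ^ 2 + Y₁ ^ 2 = r₁ ^ 2) (n₂ : X₂ ^ 2 + Y₂ ^ 2 = r₂ ^ 2)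
    (n₃ : X₃ ^ 2 + Y₃ ^ 2 = r₃ ^ 2)
    (f₁ : μ * r₁ + A * X₁ + B * Y₁ = P) (f₂ : μ * r₂ + A * X₂ + B * Y₂ = P)
    (f₃ : μ * r₃ + A * X₃ + B * Y₃ = P)
    (E₁ : X₁ ^ 2 + d * Y₁ ^ 2 = 1) (E₂ : X₂ ^ 2 + d * Y₂ ^ 2 = 1) (E₃ : X₃ ^ 2 + d * Y₃ ^ 2 = 1)
    (hne₁₂ : ¬(X₁ = X₂ ∧ Y₁ = Y₂)) (hne₁₃ : ¬(X₁ = X₃ ∧ Y₁ = Y₃))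
    (hne₂₃ : ¬(X₂ = X₃ ∧ Y₂ = Y₃)) : False := by
  obtain ⟨x₁, y₁, rfl, rfl, rfl⟩ := exists_levi_civita hr₁ n₁
  obtain ⟨x₂, y₂, rfl, rfl, rfl⟩ := exists_levi_civita hr₂ n₂
  obtain ⟨x₃, y₃, rfl, rfl, rfl⟩ := exists_levi_civita hr₃ n₃
  have q₁ : (μ + A) * x₁ ^ 2 + 2 * B * x₁ * y₁ + (μ - A) * y₁ ^ 2 = P := by linarith
  have q₂ : (μ + A) * x₂ ^ 2 + 2 * B * x₂ * y₂ + (μ - A) * y₂ ^ 2 = P := by linarith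
  have q₃ : (μ + A) * x₃ ^ 2 + 2 * B * x₃ * y₃ + (μ - A) * y₃ ^ 2 = P := by linarith
  exact no_three_points_on_hyperbola (c := 4 * d - 2) (by linarith) (by linarith) hP
    (by linarith) (by linarith) (by linarith) (by linarith) q₁ q₂ q₃
    (cross_ne_zero hP.ne' q₁ q₂ hne₁₂) (cross_ne_zero hP.ne' q₁ q₃ hne₁₃)
    (cross_ne_zero hP.ne' q₂ q₃ hne₂₃)

/-- The degenerate (rectilinear) focal form describes a ray, which meets the ellipse once. -/
theorem focal_ray_meets_ellipse {d μ A B X₁ Y₁ r₁ X₂ Y₂ r₂ : ℝ}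
    (hμ : μ ≠ 0) (hAB : A ^ 2 + B ^ 2 = μ ^ 2) (hr₁ : 0 ≤ r₁) (hr₂ : 0 ≤ r₂)
    (n₁ : X₁ ^ 2 + Y₁ ^ 2 = r₁ ^ 2) (n₂ : X₂ ^ 2 + Y₂ ^ 2 = r₂ ^ 2)
    (f₁ : μ * r₁ + A * X₁ + B * Y₁ = 0) (f₂ : μ * r₂ + A * X₂ + B * Y₂ = 0)
    (E₁ : X₁ ^ 2 + d * Y₁ ^ 2 = 1) (E₂ : X₂ ^ 2 + d * Y₂ ^ 2 = 1) :
    X₁ = X₂ ∧ Y₁ = Y₂ := by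
  have ray : ∀ {X Y r : ℝ}, X ^ 2 + Y ^ 2 = r ^ 2 → μ * r + A * X + B * Y = 0 →
      μ * X = -(A * r) ∧ μ * Y = -(B * r) := by
    intro X Y r n f
    have h : (μ * X + A * r) ^ 2 + (μ * Y + B * r) ^ 2 = 0 := by
      linear_combination μ ^ 2 * n + r ^ 2 * hAB + 2 * μ * r * f
    constructor <;> nlinarith [sq_nonneg (μ * X + A * r), sq_nonneg (μ * Y + B * r)]
  obtain ⟨a₁, b₁⟩ := ray n₁ f₁
  obtain ⟨a₂, b₂⟩ := ray n₂ f₂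
  have e₁ : r₁ ^ 2 * (A ^ 2 + d * B ^ 2) = μ ^ 2 := by
    linear_combination μ ^ 2 * E₁ - (μ * X₁ - A * r₁) * a₁ - d * (μ * Y₁ - B * r₁) * b₁
  have e₂ : r₂ ^ 2 * (A ^ 2 + d * B ^ 2) = μ ^ 2 := by
    linear_combination μ ^ 2 * E₂ - (μ * X₂ - A * r₂) * a₂ - d * (μ * Y₂ - B * r₂) * b₂
  have hr : r₁ = r₂ := by
    have hq : A ^ 2 + d * B ^ 2 ≠ 0 := by
      intro h
      rw [h, mul_zero] at e₁
      exact pow_ne_zero 2 hμ e₁.symm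
    exact (sq_eq_sq₀ hr₁ hr₂).1 (mul_right_cancel₀ hq (e₁.trans e₂.symm))
  subst hr
  exact ⟨mul_left_cancel₀ hμ (a₁.trans a₂.symm), mul_left_cancel₀ hμ (b₁.trans b₂.symm)⟩

theorem eq_of_hasDerivAt_zero {J : Set ℝ} (hJ : J.OrdConnected) {f : ℝ → ℝ}
    (hf : ∀ t ∈ J, HasDerivAt f 0 t) {s t : ℝ} (hs : s ∈ J) (ht : t ∈ J) : f s = f t := by
  have := hJ.convex.norm_image_sub_le_of_norm_hasDerivWithin_le (C := 0)
    (fun x hx => (hf x hx).hasDerivWithinAt) (fun _ _ => by simp) hs ht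
  rw [zero_mul, norm_le_zero_iff, sub_eq_zero] at this
  exact this.symm

theorem coord_sq_add_sq (p : EuclideanSpace ℝ (Fin 2)) : (p 0) ^ 2 + (p 1) ^ 2 = ‖p‖ ^ 2 := by
  rw [EuclideanSpace.norm_sq_eq]
  simp

/-- Conservation of the angular momentum and of the Laplace-Runge-Lenz vector, and the resulting
focal equation of the orbit. -/
theorem exists_focal_equation {μ En : ℝ} {J : Set ℝ} (hJ : J.OrdConnected)
    {z v : ℝ → EuclideanSpace ℝ (Fin 2)}
    (hne : ∀ t ∈ J, z t ≠ 0)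
    (hz' : ∀ t ∈ J, HasDerivAt z (v t) t)
    (hz'' : ∀ t ∈ J, HasDerivAt v ((-μ / ‖z t‖ ^ 3) • z t) t)
    (henergy : ∀ t ∈ J, (1 / 2) * ‖v t‖ ^ 2 - μ / ‖z t‖ = En) :
    ∃ L A B : ℝ, (J.Nonempty → A ^ 2 + B ^ 2 = μ ^ 2 + 2 * En * L ^ 2) ∧
      ∀ t ∈ J, μ * ‖z t‖ + A * z t 0 + B * z t 1 = L ^ 2 := by
  rcases J.eq_empty_or_nonempty with rfl | ⟨s, hs⟩
  · exact ⟨0, 0, 0, by simp, by simp⟩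
  have dcoord : ∀ {f : ℝ → EuclideanSpace ℝ (Fin 2)} {f' : EuclideanSpace ℝ (Fin 2)} {t : ℝ},
      HasDerivAt f f' t → ∀ i, HasDerivAt (fun t => f t i) (f' i) t := fun h i =>
    (EuclideanSpace.proj i : EuclideanSpace ℝ (Fin 2) →L[ℝ] ℝ).hasFDerivAt.comp_hasDerivAt _ h
  have dz : ∀ t ∈ J, ∀ i, HasDerivAt (fun t => z t i) (v t i) t := fun t ht => dcoord (hz' t ht)
  have dv : ∀ t ∈ J, ∀ i, HasDerivAt (fun t => v t i) (-μ / ‖z t‖ ^ 3 * z t i) t :=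
    fun t ht i => by simpa using dcoord (hz'' t ht) i
  have hr : ∀ t ∈ J, 0 < ‖z t‖ := fun t ht => norm_pos_iff.2 (hne t ht)
  have dr : ∀ t ∈ J, HasDerivAt (fun t => ‖z t‖) ((z t 0 * v t 0 + z t 1 * v t 1) / ‖z t‖) t := by
    intro t ht
    have h := (((dz t ht 0).pow 2).add ((dz t ht 1).pow 2)).sqrt
      (by simpa [coord_sq_add_sq] using hne t ht)
    simp only [Pi.add_apply, Pi.pow_apply, coord_sq_add_sq, Real.sqrt_sq (norm_nonneg _)] at h
    convert h using 1
    field_simp [(hr t ht).ne']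
    push_cast
    ring
  have hL : ∀ t ∈ J, HasDerivAt (fun t => z t 0 * v t 1 - z t 1 * v t 0) 0 t := by
    intro t ht
    refine (((dz t ht 0).mul (dv t ht 1)).sub ((dz t ht 1).mul (dv t ht 0))).congr_deriv ?_
    ring
  obtain ⟨L, hLs⟩ : ∃ L, ∀ t ∈ J, z t 0 * v t 1 - z t 1 * v t 0 = L :=
    ⟨_, fun t ht => eq_of_hasDerivAt_zero hJ hL ht hs⟩
  have hA : ∀ t ∈ J, HasDerivAt (fun t => v t 1 * L - μ * (z t 0 / ‖z t‖)) 0 t := by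
    intro t ht
    have hr0 := (hr t ht).ne'
    refine (((dv t ht 1).mul_const L).sub
      (((dz t ht 0).div (dr t ht) hr0).const_mul μ)).congr_deriv ?_
    rw [← hLs t ht]
    field_simp
    rw [← coord_sq_add_sq]
    ring
  have hB : ∀ t ∈ J, HasDerivAt (fun t => -(v t 0 * L) - μ * (z t 1 / ‖z t‖)) 0 t := by
    intro t ht
    have hr0 := (hr t ht).ne'
    refine (((dv t ht 0).mul_const L).neg.sub
      (((dz t ht 1).div (dr t ht) hr0).const_mul μ)).congr_deriv ?_
    rw [← hLs t ht]
    field_simp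
    rw [← coord_sq_add_sq]
    ring
  obtain ⟨A, hAs⟩ : ∃ A, ∀ t ∈ J, v t 1 * L - μ * (z t 0 / ‖z t‖) = A :=
    ⟨_, fun t ht => eq_of_hasDerivAt_zero hJ hA ht hs⟩
  obtain ⟨B, hBs⟩ : ∃ B, ∀ t ∈ J, -(v t 0 * L) - μ * (z t 1 / ‖z t‖) = B :=
    ⟨_, fun t ht => eq_of_hasDerivAt_zero hJ hB ht hs⟩
  refine ⟨L, A, B, fun _ => ?_, fun t ht => ?_⟩
  · have hr0 := (hr s hs).ne'
    have hn : (z s 0 / ‖z s‖) ^ 2 + (z s 1 / ‖z s‖) ^ 2 = 1 := by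
      rw [div_pow, div_pow, ← add_div, coord_sq_add_sq]
      exact div_self (pow_ne_zero 2 hr0)
    have hl : z s 0 / ‖z s‖ * v s 1 - z s 1 / ‖z s‖ * v s 0 = L / ‖z s‖ := by
      rw [← hLs s hs]; ring
    rw [← hAs s hs, ← hBs s hs, ← henergy s hs, ← coord_sq_add_sq]
    linear_combination μ ^ 2 * hn - 2 * μ * L * hl
  · have hr0 := (hr t ht).ne'
    have hn : z t 0 / ‖z t‖ * z t 0 + z t 1 / ‖z t‖ * z t 1 = ‖z t‖ := by
      field_simp
      exact coord_sq_add_sq _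
    rw [← hAs t ht, ← hBs t ht]
    linear_combination L * hLs t ht - μ * hn

theorem subset_pair_of_no_three {α : Type*} [Nonempty α] {S : Set α}
    (h : ∀ a ∈ S, ∀ b ∈ S, ∀ c ∈ S, a ≠ b → a ≠ c → b ≠ c → False) :
    ∃ p₁ p₂ : α, S ⊆ {p₁, p₂} := by
  by_cases hS : ∃ a ∈ S, ∃ b ∈ S, a ≠ b
  · obtain ⟨a, ha, b, hb, hab⟩ := hS
    refine ⟨a, b, fun c hc => ?_⟩
    by_contra hn
    simp only [Set.mem_insert_iff, Set.mem_singleton_iff, not_or] at hn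
    exact h a ha b hb c hc hab (Ne.symm hn.1) (Ne.symm hn.2)
  · push Not at hS
    rcases S.eq_empty_or_nonempty with rfl | ⟨a, ha⟩
    · exact ⟨Classical.arbitrary α, Classical.arbitrary α, Set.empty_subset _⟩
    · exact ⟨a, a, fun c hc => by simp [hS c hc a ha]⟩


/-- A Keplerian arc of positive energy `En` and mass parameter `μ` (an arc of a branch
of a Keplerian hyperbola with focus at the origin) intersects the boundary of the
elliptic domain of semimajor axis `1` and eccentricity `e < 1/√2` centered at the
origin in at most two points. -/
theorem kepler_arc_meets_ellipse_at_most_twice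
    (e : ℝ) (he0 : 0 ≤ e) (he : e < 1 / Real.sqrt 2)
    (μ En : ℝ) (hμ : 0 < μ) (hEn : 0 < En)
    (J : Set ℝ) (hJ : J.OrdConnected)
    (z v : ℝ → EuclideanSpace ℝ (Fin 2))
    (hne : ∀ t ∈ J, z t ≠ 0)
    (hz' : ∀ t ∈ J, HasDerivAt z (v t) t)
    (hz'' : ∀ t ∈ J, HasDerivAt v ((-μ / ‖z t‖ ^ 3) • z t) t)
    (henergy : ∀ t ∈ J, (1 / 2) * ‖v t‖ ^ 2 - μ / ‖z t‖ = En) :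
    ∃ p₁ p₂ : EuclideanSpace ℝ (Fin 2),
      (z '' J) ∩ {p : EuclideanSpace ℝ (Fin 2) |
          (p 0) ^ 2 + (p 1) ^ 2 / Real.sqrt (1 - e ^ 2) ^ 2 = 1} ⊆ {p₁, p₂} := by
  have he2 : e ^ 2 < 1 / 2 := by
    have h := pow_lt_pow_left₀ he he0 two_ne_zero
    rwa [div_pow, one_pow, Real.sq_sqrt zero_le_two] at h
  have hb : 0 < 1 - e ^ 2 := by linarith
  have hd1 : 1 ≤ 1 / (1 - e ^ 2) := by
    rw [le_div_iff₀ hb]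
    linarith [sq_nonneg e]
  have hd2 : 1 / (1 - e ^ 2) < 2 := by
    rw [div_lt_iff₀ hb]
    linarith
  obtain ⟨L, A, B, hAB, hf⟩ := exists_focal_equation hJ hne hz' hz'' henergy
  have eq_of_coord : ∀ p q : EuclideanSpace ℝ (Fin 2), p 0 = q 0 ∧ p 1 = q 1 → p = q :=
    fun p q h => by
      ext i
      fin_cases i
      exacts [h.1, h.2]
  have ellipse : ∀ p : EuclideanSpace ℝ (Fin 2),
      (p 0) ^ 2 + (p 1) ^ 2 / Real.sqrt (1 - e ^ 2) ^ 2 = 1 →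
        (p 0) ^ 2 + 1 / (1 - e ^ 2) * (p 1) ^ 2 = 1 := fun p h => by
    rwa [Real.sq_sqrt hb.le, ← one_div_mul_eq_div] at h
  apply subset_pair_of_no_three
  rintro _ ⟨⟨t₁, ht₁, rfl⟩, E₁⟩ _ ⟨⟨t₂, ht₂, rfl⟩, E₂⟩ _ ⟨⟨t₃, ht₃, rfl⟩, E₃⟩ hne₁₂ hne₁₃ hne₂₃
  replace E₁ := ellipse _ E₁
  replace E₂ := ellipse _ E₂
  replace E₃ := ellipse _ E₃
  specialize hAB ⟨t₁, ht₁⟩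
  rcases eq_or_ne L 0 with rfl | hL
  · refine hne₁₂ (eq_of_coord _ _ (focal_ray_meets_ellipse (A := A) (B := B) hμ.ne'
      (by linarith) (norm_nonneg _) (norm_nonneg _) (coord_sq_add_sq _) (coord_sq_add_sq _) ?_ ?_ E₁ E₂))
    · simpa using hf t₁ ht₁
    · simpa using hf t₂ ht₂
  · have hL2 : 0 < L ^ 2 := by positivity
    exact focal_hyperbola_meets_ellipse hd1 hd2 hL2 (by nlinarith [mul_pos hEn hL2])
      (norm_nonneg _) (norm_nonneg _) (norm_nonneg _)
      (coord_sq_add_sq _) (coord_sq_add_sq _) (coord_sq_add_sq _)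
      (hf t₁ ht₁) (hf t₂ ht₂) (hf t₃ ht₃) E₁ E₂ E₃ (fun h => hne₁₂ (eq_of_coord _ _ h))
      (fun h => hne₁₃ (eq_of_coord _ _ h)) (fun h => hne₂₃ (eq_of_coord _ _ h))
end

section
/- There exists a constant C ∈ (0, π), depending on the physical parameters 𝓔, ω, μ, h, such that for every ρ ∈ (−C, C) there exists an action value I ∈ (−I_c, I_c) with θ_E(I) + θ_I(I) = ρ; that is, every rotation number ρ ∈ (−C, C) is realized by an invariant circle {(ξ, I) : ξ ∈ ℝ/2πℤ} of the circular refraction billiard's first return map. -/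
/-- `arccot` with values in `(0, π)`. -/
noncomputable def arccot (x : ℝ) : ℝ := Real.pi / 2 - Real.arctan x

/-- The angular shift produced by the outer (harmonic oscillator) arc of the
circular refraction billiard, as a function of the action `I`. -/
noncomputable def thetaE (E ω I : ℝ) : ℝ :=
  if 0 < I then
    arccot ((E - 2 * I ^ 2) / (I * Real.sqrt (4 * E - 2 * (2 * I ^ 2 + ω ^ 2))))
  else if I < 0 then
    arccot ((E - 2 * I ^ 2) / (I * Real.sqrt (4 * E - 2 * (2 * I ^ 2 + ω ^ 2)))) - Real.pi
  else 0

/-- The angular shift produced by the inner (Keplerian) arc of the circular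
refraction billiard, as a function of the action `I`. -/
noncomputable def thetaI (E h μ I : ℝ) : ℝ :=
  if 0 < I then
    2 * Real.arccos ((2 * I ^ 2 - μ) / Real.sqrt (4 * (E + h) * I ^ 2 + μ ^ 2)) - 2 * Real.pi
  else if I < 0 then
    -(2 * Real.arccos ((2 * I ^ 2 - μ) / Real.sqrt (4 * (E + h) * I ^ 2 + μ ^ 2))) + 2 * Real.pi
  else 0

open Real in
/-- `arccot` as an `arccos`. -/
theorem arccot_div_eq_arccos (a : ℝ) {b : ℝ} (hb : 0 < b) :
    arccot (a / b) = arccos (a / √(a ^ 2 + b ^ 2)) := by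
  have h : √(1 + (a / b) ^ 2) = √(a ^ 2 + b ^ 2) / b := by
    rw [show 1 + (a / b) ^ 2 = (a ^ 2 + b ^ 2) / b ^ 2 by field_simp; ring,
      sqrt_div' _ (sq_nonneg b), sqrt_sq hb.le]
  rw [arccot, arctan_eq_arcsin, arccos, h, div_div_div_cancel_right₀ hb.ne']

theorem arccot_neg (x : ℝ) : arccot (-x) = Real.pi - arccot x := by
  simp only [arccot, Real.arctan_neg]
  ring

theorem thetaE_neg (E ω I : ℝ) : thetaE E ω (-I) = -thetaE E ω I := by
  rcases lt_trichotomy I 0 with hI | rfl | hI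
  · simp [thetaE, hI, hI.not_gt, div_neg, arccot_neg]
  · simp [thetaE]
  · simp [thetaE, hI, hI.not_gt, div_neg, arccot_neg]

theorem thetaI_neg (E h μ I : ℝ) : thetaI E h μ (-I) = -thetaI E h μ I := by
  rcases lt_trichotomy I 0 with hI | rfl | hI
  · simp [thetaI, hI, hI.not_gt]; ring
  · simp [thetaI]
  · simp [thetaI, hI, hI.not_gt]; ring

/-- A form of `thetaE` that is continuous up to `I = 0`. -/
theorem thetaE_eq_arccos {E ω I : ℝ} (hE : 0 < E) (hI : 0 ≤ I) (hIc : I ^ 2 < E - ω ^ 2 / 2) :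
    thetaE E ω I = Real.arccos ((E - 2 * I ^ 2) / √(E ^ 2 - 2 * ω ^ 2 * I ^ 2)) := by
  rcases hI.eq_or_lt with rfl | hI
  · simp [thetaE, Real.sqrt_sq hE.le, hE.ne']
  · have hpos : 0 < 4 * E - 2 * (2 * I ^ 2 + ω ^ 2) := by linarith
    rw [thetaE, if_pos hI, arccot_div_eq_arccos _ (mul_pos hI (Real.sqrt_pos.2 hpos)),
      mul_pow, Real.sq_sqrt hpos.le]
    congr 3
    ring

/-- A form of `thetaI` that is continuous up to `I = 0`. -/
theorem thetaI_eq_arccos {E h μ I : ℝ} (hμ : 0 < μ) (hI : 0 ≤ I) :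
    thetaI E h μ I =
      2 * Real.arccos ((2 * I ^ 2 - μ) / √(4 * (E + h) * I ^ 2 + μ ^ 2)) - 2 * Real.pi := by
  rcases hI.eq_or_lt with rfl | hI
  · simp [thetaI, Real.sqrt_sq hμ.le, neg_div, div_self hμ.ne']
  · rw [thetaI, if_pos hI]

theorem discriminant_pos {E ω x : ℝ} (hω : 0 < ω) (hx : x < E - ω ^ 2 / 2) :
    0 < E ^ 2 - 2 * ω ^ 2 * x := by
  nlinarith [sq_nonneg (E - ω ^ 2), mul_lt_mul_of_pos_left hx (pow_pos hω 2)]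

theorem continuousOn_thetaE_add_thetaI {E ω μ h r : ℝ} (hE : 0 < E) (hω : 0 < ω) (hμ : 0 < μ)
    (hh : 0 < h) (hr : r ^ 2 < E - ω ^ 2 / 2) :
    ContinuousOn (fun I => thetaE E ω I + thetaI E h μ I) (Set.Icc 0 r) := by
  have hlt : ∀ I ∈ Set.Icc 0 r, I ^ 2 < E - ω ^ 2 / 2 := fun I hI =>
    (pow_le_pow_left₀ hI.1 hI.2 2).trans_lt hr
  have hcont : ContinuousOn (fun I : ℝ =>
      Real.arccos ((E - 2 * I ^ 2) / √(E ^ 2 - 2 * ω ^ 2 * I ^ 2)) +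
      (2 * Real.arccos ((2 * I ^ 2 - μ) / √(4 * (E + h) * I ^ 2 + μ ^ 2)) - 2 * Real.pi))
      (Set.Icc 0 r) := by
    refine .add (Real.continuous_arccos.comp_continuousOn (.div (by fun_prop) (by fun_prop) ?_))
      (.sub (.mul continuousOn_const
        (Real.continuous_arccos.comp_continuousOn (.div (by fun_prop) (by fun_prop) ?_)))
        continuousOn_const)
    · exact fun I hI => (Real.sqrt_pos.2 (discriminant_pos hω (hlt I hI))).ne'
    · exact fun I _ => (Real.sqrt_pos.2 (by positivity)).ne'
  exact hcont.congr fun I hI => by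
    simp only [thetaE_eq_arccos hE hI.1 (hlt I hI), thetaI_eq_arccos hμ hI.1]

theorem div_sqrt_mem_Icc {a d : ℝ} (hd : 0 < d) (h : a ^ 2 ≤ d) : a / √d ∈ Set.Icc (-1) 1 := by
  rw [Set.mem_Icc, ← abs_le, ← sq_le_one_iff_abs_le_one, div_pow, Real.sq_sqrt hd.le]
  exact (div_le_one hd).2 h

/-- The algebraic equation in `x = I ^ 2` satisfied where the two angular shifts cancel. -/
theorem algebraic_of_thetaE_add_thetaI_eq_zero {E ω μ h x : ℝ} (hE : 0 < E) (hω : 0 < ω)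
    (hμ : 0 < μ) (hh : 0 < h) (hx : 0 < x) (hxc : x < E - ω ^ 2 / 2)
    (hzero : thetaE E ω √x + thetaI E h μ √x = 0) :
    (E - 2 * x) ^ 2 * (4 * (E + h) * x + μ ^ 2) ^ 2 =
      (E ^ 2 - 2 * ω ^ 2 * x) * (2 * (2 * x - μ) ^ 2 - (4 * (E + h) * x + μ ^ 2)) ^ 2 := by
  have hsq := Real.sq_sqrt hx.le
  rw [thetaE_eq_arccos hE (Real.sqrt_nonneg x) (hsq.symm ▸ hxc),
    thetaI_eq_arccos hμ (Real.sqrt_nonneg x), hsq] at hzero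
  have hd := discriminant_pos hω hxc
  have hD : 0 < 4 * (E + h) * x + μ ^ 2 := by positivity
  have hA := div_sqrt_mem_Icc (a := E - 2 * x) hd
    (by nlinarith [mul_pos hx (sub_pos.2 hxc)])
  have hB := div_sqrt_mem_Icc (a := 2 * x - μ) hD
    (by nlinarith [mul_pos hx (sub_pos.2 hxc), mul_pos hx hh, mul_pos hx hμ,
      mul_pos hx (pow_pos hω 2)])
  set A := (E - 2 * x) / √(E ^ 2 - 2 * ω ^ 2 * x) with hAdef
  set B := (2 * x - μ) / √(4 * (E + h) * x + μ ^ 2) with hBdef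
  have hAB : A = 2 * B ^ 2 - 1 := by
    rw [← Real.cos_arccos hA.1 hA.2,
      show Real.arccos A = 2 * Real.pi - 2 * Real.arccos B by linarith,
      Real.cos_two_pi_sub, Real.cos_two_mul, Real.cos_arccos hB.1 hB.2]
  have hA2 : A ^ 2 = (E - 2 * x) ^ 2 / (E ^ 2 - 2 * ω ^ 2 * x) := by
    rw [hAdef, div_pow, Real.sq_sqrt hd.le]
  have hB2 : B ^ 2 = (2 * x - μ) ^ 2 / (4 * (E + h) * x + μ ^ 2) := by
    rw [hBdef, div_pow, Real.sq_sqrt hD.le]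
  have key := hA2
  rw [hAB, hB2] at key
  generalize E ^ 2 - 2 * ω ^ 2 * x = d at hd key ⊢
  generalize 4 * (E + h) * x + μ ^ 2 = D at hD key ⊢
  field_simp at key
  linarith

/-- The rotation number does not vanish identically on positive actions. -/
theorem exists_thetaE_add_thetaI_ne_zero {E ω μ h : ℝ} (hE : 0 < E) (hω : 0 < ω)
    (hμ : 0 < μ) (hh : 0 < h) (hEω : ω ^ 2 / 2 < E) :
    ∃ I : ℝ, 0 < I ∧ I ^ 2 < E - ω ^ 2 / 2 ∧ thetaE E ω I + thetaI E h μ I ≠ 0 := by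
  by_contra! hall
  let P : Polynomial ℝ :=
    (.C E - 2 * .X) ^ 2 * (.C (4 * (E + h)) * .X + .C (μ ^ 2)) ^ 2 -
      (.C (E ^ 2) - .C (2 * ω ^ 2) * .X) *
        (2 * (2 * .X - .C μ) ^ 2 - (.C (4 * (E + h)) * .X + .C (μ ^ 2))) ^ 2
  have heval : ∀ x, P.eval x = (E - 2 * x) ^ 2 * (4 * (E + h) * x + μ ^ 2) ^ 2 -
      (E ^ 2 - 2 * ω ^ 2 * x) * (2 * (2 * x - μ) ^ 2 - (4 * (E + h) * x + μ ^ 2)) ^ 2 := by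
    intro x
    simp [P]
  have hP : P = 0 := by
    refine Polynomial.eq_zero_of_infinite_isRoot P
      ((Set.Ioo_infinite (sub_pos.2 hEω)).mono fun x hx => ?_)
    have hzero := hall √x (Real.sqrt_pos.2 hx.1) ((Real.sq_sqrt hx.1.le).symm ▸ hx.2)
    rw [Set.mem_ofPred_eq, Polynomial.IsRoot, heval]
    exact sub_eq_zero.2 (algebraic_of_thetaE_add_thetaI_eq_zero hE hω hμ hh hx.1 hx.2 hzero)
  -- Beyond `x = E ^ 2 / (2 * ω ^ 2)` the two sides of the equation have opposite signs.
  obtain ⟨x, hx⟩ : ∃ x, x = E ^ 2 / (2 * ω ^ 2) + E := ⟨_, rfl⟩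
  have hxE : E < x := by rw [hx]; linarith [show 0 < E ^ 2 / (2 * ω ^ 2) by positivity]
  have hneg : E ^ 2 - 2 * ω ^ 2 * x < 0 := by
    have : E ^ 2 - 2 * ω ^ 2 * x = -(2 * ω ^ 2 * E) := by rw [hx]; field_simp; ring
    rw [this]
    exact neg_lt_zero.2 (by positivity)
  have hx0 : 0 < x := hE.trans hxE
  have hpos : 0 < (E - 2 * x) ^ 2 * (4 * (E + h) * x + μ ^ 2) ^ 2 :=
    mul_pos (sq_pos_of_neg (by linarith)) (by positivity)
  have hroot := heval x
  rw [hP, Polynomial.eval_zero] at hroot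
  linarith [mul_nonpos_of_nonpos_of_nonneg hneg.le
    (sq_nonneg (2 * (2 * x - μ) ^ 2 - (4 * (E + h) * x + μ ^ 2)))]

/-- Every rotation number `ρ ∈ (−C, C)` is realized by an invariant circle of the
circular refraction billiard's first return map. -/
theorem circular_billiard_realizes_rotation_numbers
    (E ω μ h : ℝ) (hE : 0 < E) (hω : 0 < ω) (hμ : 0 < μ) (hh : 0 < h)
    (hEω : ω ^ 2 / 2 < E) :
    ∃ C : ℝ, 0 < C ∧ C < Real.pi ∧
      ∀ ρ ∈ Set.Ioo (-C) C,
        ∃ I ∈ Set.Ioo (-Real.sqrt (E - ω ^ 2 / 2)) (Real.sqrt (E - ω ^ 2 / 2)),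
          thetaE E ω I + thetaI E h μ I = ρ := by
  obtain ⟨r, hr0, hrc, hr⟩ := exists_thetaE_add_thetaI_ne_zero hE hω hμ hh hEω
  set f : ℝ → ℝ := fun I => thetaE E ω I + thetaI E h μ I with hf
  have hf0 : f 0 = 0 := by simp [hf, thetaE, thetaI]
  have hfneg : ∀ I, f (-I) = -f I := fun I => by
    simp only [hf, thetaE_neg, thetaI_neg]
    ring
  have hcont : ContinuousOn f (Set.uIcc 0 r) := by
    rw [Set.uIcc_of_le hr0.le]
    exact continuousOn_thetaE_add_thetaI hE hω hμ hh hrc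
  have hivt := intermediate_value_uIcc hcont
  rw [hf0, Set.uIcc_of_le hr0.le] at hivt
  have hbound : ∀ I ∈ Set.Icc 0 r,
      -√(E - ω ^ 2 / 2) < I ∧ I < √(E - ω ^ 2 / 2) := fun I hI =>
    abs_lt.1 (Real.lt_sqrt_of_sq_lt ((sq_abs I).symm ▸
      (pow_le_pow_left₀ hI.1 hI.2 2).trans_lt hrc))
  refine ⟨min |f r| (Real.pi / 2), lt_min (abs_pos.2 hr) (by positivity),
    (min_le_right _ _).trans_lt (by linarith [Real.pi_pos]), fun ρ hρ => ?_⟩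
  have hρr : |ρ| < |f r| := (abs_lt.2 hρ).trans_le (min_le_left _ _)
  have hmem : ρ ∈ Set.uIcc 0 (f r) ∨ -ρ ∈ Set.uIcc 0 (f r) := by
    simp only [Set.mem_uIcc]
    grind
  rcases hmem with hmem | hmem
  · obtain ⟨I, hI, hIρ⟩ := hivt hmem
    exact ⟨I, hbound I hI, hIρ⟩
  · obtain ⟨I, hI, hIρ⟩ := hivt hmem
    obtain ⟨hl, hu⟩ := hbound I hI
    exact ⟨-I, ⟨neg_lt_neg hu, neg_lt.1 hl⟩, (hfneg I).trans (by rw [hIρ, neg_neg])⟩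
end

section
/- There exists a constant C ∈ (0, π), depending on the physical parameters 𝓔, ω, μ, h, such that for all integers p, q with q ≥ 1 and |2πp/q| < C there exists I ∈ (−I_c, I_c) with q·(θ_E(I) + θ_I(I)) = 2πp; consequently, for every ξ₀ ∈ ℝ the q-th iterate of the lifted shift map F(ξ, I) = (ξ + θ_E(I) + θ_I(I), I) satisfies F^q(ξ₀, I) = (ξ₀ + 2πp, I), i.e. through every boundary point there is a (p, q)-periodic orbit of the circular refraction billiard. -/
theorem arccot_eq_arctan_inv_of_pos {x : ℝ} (hx : 0 < x) : arccot x = Real.arctan x⁻¹ := by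
  rw [arccot, Real.arctan_inv_of_pos hx]

theorem arccot_eq_arctan_inv_add_pi_of_neg {x : ℝ} (hx : x < 0) :
    arccot x = Real.arctan x⁻¹ + Real.pi := by
  rw [arccot, Real.arctan_inv_of_neg hx]
  ring

/-- The tangent of the outer shift. -/
noncomputable def tanOuter (E ω I : ℝ) : ℝ :=
  I * Real.sqrt (4 * E - 2 * (2 * I ^ 2 + ω ^ 2)) / (E - 2 * I ^ 2)

/-- The tangent of half the opposite of the inner shift. -/
noncomputable def tanHalfInner (E h μ I : ℝ) : ℝ :=
  2 * I * Real.sqrt (E + h + μ - I ^ 2) / (μ - 2 * I ^ 2)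

theorem thetaE_eq_arctan {E ω I : ℝ} (hI : I ^ 2 < E - ω ^ 2 / 2) (hIE : 2 * I ^ 2 < E) :
    thetaE E ω I = Real.arctan (tanOuter E ω I) := by
  have hs : 0 < Real.sqrt (4 * E - 2 * (2 * I ^ 2 + ω ^ 2)) := Real.sqrt_pos.2 (by linarith)
  have hn : 0 < E - 2 * I ^ 2 := by linarith
  unfold thetaE tanOuter
  split_ifs with h1 h2
  · rw [arccot_eq_arctan_inv_of_pos (by positivity), inv_div]
  · rw [arccot_eq_arctan_inv_add_pi_of_neg
      (div_neg_of_pos_of_neg hn (mul_neg_of_neg_of_pos h2 hs)), inv_div]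
    ring
  · obtain rfl : I = 0 := le_antisymm (not_lt.1 h1) (not_lt.1 h2)
    simp

theorem arccos_eq_pi_sub_arctan {E h μ I : ℝ} (hIμ : 2 * I ^ 2 < μ) (hEh : 0 < E + h) :
    Real.arccos ((2 * I ^ 2 - μ) / Real.sqrt (4 * (E + h) * I ^ 2 + μ ^ 2)) =
      Real.pi - Real.arctan (2 * |I| * Real.sqrt (E + h + μ - I ^ 2) / (μ - 2 * I ^ 2)) := by
  have hμ : 0 < μ := by nlinarith [sq_nonneg I]
  have hD : 0 < 4 * (E + h) * I ^ 2 + μ ^ 2 := by positivity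
  have hs := Real.sqrt_pos.2 hD
  have hn : 0 < μ - 2 * I ^ 2 := by linarith
  have hneg : (2 * I ^ 2 - μ) / Real.sqrt (4 * (E + h) * I ^ 2 + μ ^ 2) =
      -((μ - 2 * I ^ 2) / Real.sqrt (4 * (E + h) * I ^ 2 + μ ^ 2)) := by ring
  have hsq : 1 - ((μ - 2 * I ^ 2) / Real.sqrt (4 * (E + h) * I ^ 2 + μ ^ 2)) ^ 2 =
      (2 * |I|) ^ 2 * (E + h + μ - I ^ 2) / (4 * (E + h) * I ^ 2 + μ ^ 2) := by
    rw [div_pow, Real.sq_sqrt hD.le, mul_pow, sq_abs]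
    field_simp
    ring
  rw [hneg, Real.arccos_neg, Real.arccos_eq_arctan (by positivity), hsq,
    Real.sqrt_div (mul_nonneg (by positivity) (by nlinarith [sq_nonneg I])), Real.sqrt_mul (by positivity),
    Real.sqrt_sq (by positivity), div_div_div_cancel_right₀ hs.ne']

theorem thetaI_eq_arctan {E h μ I : ℝ} (hIμ : 2 * I ^ 2 < μ) (hEh : 0 < E + h) :
    thetaI E h μ I = -2 * Real.arctan (tanHalfInner E h μ I) := by
  unfold thetaI tanHalfInner
  rw [arccos_eq_pi_sub_arctan hIμ hEh]
  split_ifs with h1 h2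
  · rw [abs_of_pos h1]
    ring
  · rw [abs_of_neg h2, mul_neg, neg_mul, neg_div, Real.arctan_neg]
    ring
  · obtain rfl : I = 0 := le_antisymm (not_lt.1 h1) (not_lt.1 h2)
    simp

theorem polynomial_identity_of_arctan_eq {E ω h μ I : ℝ} (hI : I ^ 2 < E - ω ^ 2 / 2)
    (hIE : 2 * I ^ 2 < E) (hIμ : 2 * I ^ 2 < μ) (hEh : 0 < E + h)
    (heq : Real.arctan (tanOuter E ω I) = 2 * Real.arctan (tanHalfInner E h μ I)) :
    (E - 2 * I ^ 2) ^ 2 * (4 * (E + h) * I ^ 2 + μ ^ 2) ^ 2 =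
      (E ^ 2 - 2 * ω ^ 2 * I ^ 2) *
        (2 * (μ - 2 * I ^ 2) ^ 2 - (4 * (E + h) * I ^ 2 + μ ^ 2)) ^ 2 := by
  have hcos := congrArg (fun x => Real.cos x ^ 2) heq
  simp only [Real.cos_two_mul, Real.cos_sq_arctan] at hcos
  have hE : 0 < E - 2 * I ^ 2 := by linarith
  have hμ' : 0 < μ - 2 * I ^ 2 := by linarith
  have hμ : 0 < μ := by nlinarith [sq_nonneg I]
  have hD : 0 < 4 * (E + h) * I ^ 2 + μ ^ 2 := by positivity
  have hB : 0 < E ^ 2 - 2 * ω ^ 2 * I ^ 2 := by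
    nlinarith [mul_nonneg (sq_nonneg I) (sub_nonneg.2 hI.le), sq_pos_of_pos hE]
  have h1 : 1 / (1 + tanOuter E ω I ^ 2) =
      (E - 2 * I ^ 2) ^ 2 / (E ^ 2 - 2 * ω ^ 2 * I ^ 2) := by
    have : 1 + tanOuter E ω I ^ 2 = (E ^ 2 - 2 * ω ^ 2 * I ^ 2) / (E - 2 * I ^ 2) ^ 2 := by
      rw [tanOuter, div_pow, mul_pow, Real.sq_sqrt (by linarith), one_add_div (by positivity)]
      ring
    rw [this, one_div_div]
  have h2 : 1 / (1 + tanHalfInner E h μ I ^ 2) =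
      (μ - 2 * I ^ 2) ^ 2 / (4 * (E + h) * I ^ 2 + μ ^ 2) := by
    have : 1 + tanHalfInner E h μ I ^ 2 =
        (4 * (E + h) * I ^ 2 + μ ^ 2) / (μ - 2 * I ^ 2) ^ 2 := by
      rw [tanHalfInner, div_pow, mul_pow, Real.sq_sqrt (by nlinarith [sq_nonneg I]),
        one_add_div (by positivity)]
      ring
    rw [this, one_div_div]
  have h3 : 2 * ((μ - 2 * I ^ 2) ^ 2 / (4 * (E + h) * I ^ 2 + μ ^ 2)) - 1 =
      (2 * (μ - 2 * I ^ 2) ^ 2 - (4 * (E + h) * I ^ 2 + μ ^ 2)) /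
        (4 * (E + h) * I ^ 2 + μ ^ 2) := by
    rw [sub_div, div_self hD.ne', mul_div_assoc]
  rw [h1, h2, h3, div_pow, div_eq_div_iff hB.ne' (by positivity)] at hcos
  linarith

/-- The two shifts do not cancel identically near the zero action. -/
theorem exists_arctan_ne {E ω h μ T : ℝ} (hT : 0 < T) (hω : 0 < ω) (hTI : T < E - ω ^ 2 / 2)
    (hTE : 2 * T < E) (hTμ : 2 * T < μ) (hEh : 0 < E + h) :
    ∃ I, I ^ 2 ≤ T ∧
      Real.arctan (tanOuter E ω I) - 2 * Real.arctan (tanHalfInner E h μ I) ≠ 0 := by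
  by_contra! hzero
  have key : ∀ t, 0 ≤ t → t ≤ T →
      (E - 2 * t) ^ 2 * (4 * (E + h) * t + μ ^ 2) ^ 2 =
        (E ^ 2 - 2 * ω ^ 2 * t) *
          (2 * (μ - 2 * t) ^ 2 - (4 * (E + h) * t + μ ^ 2)) ^ 2 := by
    intro t ht0 htT
    have hsq := Real.sq_sqrt ht0
    have := polynomial_identity_of_arctan_eq (E := E) (ω := ω) (h := h) (μ := μ)
      (I := Real.sqrt t) (by linarith) (by linarith) (by linarith) hEh
      (sub_eq_zero.1 (hzero _ (by linarith)))
    rwa [hsq] at this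
  obtain ⟨d, rfl⟩ : ∃ d, T = 5 * d := ⟨T / 5, by ring⟩
  have hd : 0 < d := by linarith
  have e0 := key 0 le_rfl (by linarith)
  have e1 := key d (by linarith) (by linarith)
  have e2 := key (2 * d) (by linarith) (by linarith)
  have e3 := key (3 * d) (by linarith) (by linarith)
  have e4 := key (4 * d) (by linarith) (by linarith)
  have e5 := key (5 * d) (by linarith) (by linarith)
  have hlead : 15360 * ω ^ 2 * d ^ 5 = 0 := by
    linear_combination e5 - 5 * e4 + 10 * e3 - 10 * e2 + 5 * e1 - e0
  exact absurd hlead (by positivity)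

theorem iterate_shift {α : Type*} (f g : α → ℝ) (n : ℕ) (ξ : ℝ) (I : α) :
    (fun x : ℝ × α => (x.1 + f x.2 + g x.2, x.2))^[n] (ξ, I) = (ξ + n * (f I + g I), I) := by
  induction n with
  | zero => simp
  | succ n ih =>
    rw [Function.iterate_succ_apply', ih]
    ext
    · push_cast
      ring
    · rfl

/-- Through every boundary point of the circular refraction billiard there is a
`(p, q)`-periodic orbit, for every `2π`-rational rotation number `2πp/q` in `(−C, C)`. -/
theorem circular_billiard_periodic_orbits
    (E ω μ h : ℝ) (hE : 0 < E) (hω : 0 < ω) (hμ : 0 < μ) (hh : 0 < h)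
    (hEω : ω ^ 2 / 2 < E) :
    ∃ C : ℝ, 0 < C ∧ C < Real.pi ∧
      ∀ (p : ℤ) (q : ℕ), 1 ≤ q → |2 * Real.pi * (p : ℝ) / (q : ℝ)| < C →
        ∃ I ∈ Set.Ioo (-Real.sqrt (E - ω ^ 2 / 2)) (Real.sqrt (E - ω ^ 2 / 2)),
          (q : ℝ) * (thetaE E ω I + thetaI E h μ I) = 2 * Real.pi * (p : ℝ) ∧
          ∀ ξ₀ : ℝ,
            (fun x : ℝ × ℝ => (x.1 + thetaE E ω x.2 + thetaI E h μ x.2, x.2))^[q] (ξ₀, I)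
              = (ξ₀ + 2 * Real.pi * (p : ℝ), I) := by
  have hIc : 0 < E - ω ^ 2 / 2 := by linarith
  obtain ⟨T, hT, hT'⟩ : ∃ T, 0 < T ∧ T < min (E - ω ^ 2 / 2) (min (E / 2) (μ / 2)) :=
    exists_between (by positivity)
  simp only [lt_min_iff] at hT'
  obtain ⟨hTI, hTE, hTμ⟩ := hT'
  obtain ⟨I₀, hI₀, hne⟩ := exists_arctan_ne (h := h) hT hω hTI (by linarith : 2 * T < E)
    (by linarith : 2 * T < μ) (by linarith)
  set g : ℝ → ℝ := fun I =>
    Real.arctan (tanOuter E ω I) - 2 * Real.arctan (tanHalfInner E h μ I) with hg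
  have hodd : g (-I₀) = -g I₀ := by
    simp only [hg, tanOuter, tanHalfInner, neg_sq, neg_mul, mul_neg, neg_div, Real.arctan_neg]
    ring
  have hsq : ∀ I ∈ Set.uIcc (-I₀) I₀, I ^ 2 ≤ T := fun I hI => by
    refine le_trans (sq_le_sq.2 ?_) hI₀
    rw [Set.mem_uIcc] at hI
    rcases hI with hI | hI
    · exact (abs_le.2 hI).trans (le_abs_self I₀)
    · exact (abs_le.2 ⟨by linarith, hI.2⟩).trans (neg_le_abs I₀)
  have hcont : ContinuousOn g (Set.uIcc (-I₀) I₀) := by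
    have h1 : ContinuousOn (tanOuter E ω) (Set.uIcc (-I₀) I₀) :=
      ContinuousOn.div (by fun_prop) (by fun_prop) fun I hI => by
        have := hsq I hI
        exact ne_of_gt (by linarith)
    have h2 : ContinuousOn (tanHalfInner E h μ) (Set.uIcc (-I₀) I₀) :=
      ContinuousOn.div (by fun_prop) (by fun_prop) fun I hI => by
        have := hsq I hI
        exact ne_of_gt (by linarith)
    exact (Real.continuous_arctan.comp_continuousOn h1).sub
      (continuousOn_const.mul (Real.continuous_arctan.comp_continuousOn h2))
  refine ⟨min |g I₀| 1, lt_min (abs_pos.2 hne) one_pos,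
    (min_le_right _ _).trans_lt (by linarith [Real.pi_gt_three]), fun p q hq hpq => ?_⟩
  have hmem : 2 * Real.pi * (p : ℝ) / (q : ℝ) ∈ Set.uIcc (g (-I₀)) (g I₀) := by
    have hlt := abs_lt.1 (hpq.trans_le (min_le_left _ _))
    rw [hodd, Set.mem_uIcc]
    rcases abs_cases (g I₀) with ⟨ha, -⟩ | ⟨ha, -⟩ <;> rw [ha] at hlt
    · exact Or.inl ⟨hlt.1.le, hlt.2.le⟩
    · exact Or.inr ⟨by linarith, by linarith⟩
  obtain ⟨I, hI, hgI⟩ := intermediate_value_uIcc hcont hmem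
  have hIT := hsq I hI
  have hshift : (q : ℝ) * (thetaE E ω I + thetaI E h μ I) = 2 * Real.pi * (p : ℝ) := by
    rw [thetaE_eq_arctan (by linarith) (by linarith),
      thetaI_eq_arctan (by linarith) (by linarith)]
    have hq0 : (q : ℝ) ≠ 0 := Nat.cast_ne_zero.2 (by omega)
    rw [eq_div_iff hq0] at hgI
    rw [← hgI]
    ring
  refine ⟨I, abs_lt.1 (Real.lt_sqrt_of_sq_lt ?_), hshift, fun ξ₀ => ?_⟩
  · rw [sq_abs]
    linarith
  · rw [iterate_shift, hshift]
end

section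
/- There exists a nonempty open set U ⊆ ℝ⁴ of the physical parameters such that every (𝓔, ω, μ, h) ∈ U satisfies 𝓔, ω, μ, h > 0 and 𝓔 > ω²/2, and for each such parameter choice there exist I ∈ (0, I_c) and an integer k with θ_E(I) + θ_I(I) = 2πk; equivalently, the circular first return map F(ξ, I) = (ξ + θ_E(I) + θ_I(I), I) on (ℝ/2πℤ) × (−I_c, I_c) admits at least two non-homothetic fixed points (the points (ξ, I) and (ξ, −I) with I ≠ 0). -/
theorem arccot_le_pi_div_two {x : ℝ} (hx : 0 ≤ x) : arccot x ≤ Real.pi / 2 := by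
  have := Real.arctan_nonneg.2 hx
  simp only [arccot]
  linarith

theorem three_pi_div_four_le_arccot {x : ℝ} (hx : x ≤ -1) : 3 * Real.pi / 4 ≤ arccot x := by
  have := Real.arctan_mono hx
  rw [Real.arctan_neg, Real.arctan_one] at this
  simp only [arccot]
  linarith

theorem continuousOn_thetaE (E ω : ℝ) :
    ContinuousOn (thetaE E ω) {I | 0 < I ∧ I ^ 2 < E - ω ^ 2 / 2} := by
  have hc : ContinuousOn (fun I : ℝ => arccot ((E - 2 * I ^ 2) /
      (I * Real.sqrt (4 * E - 2 * (2 * I ^ 2 + ω ^ 2))))) {I | 0 < I ∧ I ^ 2 < E - ω ^ 2 / 2} := by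
    unfold arccot
    refine continuousOn_const.sub (Real.continuous_arctan.comp_continuousOn ?_)
    refine ContinuousOn.div (by fun_prop) (by fun_prop) fun I hI => ?_
    exact (mul_pos hI.1 (Real.sqrt_pos.2 (by linarith [hI.2]))).ne'
  exact hc.congr fun I hI => by simp [thetaE, hI.1]

theorem continuousOn_thetaI {E h μ : ℝ} (hEh : 0 ≤ E + h) (hμ : 0 < μ) :
    ContinuousOn (thetaI E h μ) (Set.Ioi 0) := by
  have hc : Continuous (fun I : ℝ => 2 * Real.arccos ((2 * I ^ 2 - μ) /
      Real.sqrt (4 * (E + h) * I ^ 2 + μ ^ 2)) - 2 * Real.pi) := by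
    have hq : Continuous (fun I : ℝ => (2 * I ^ 2 - μ) /
        Real.sqrt (4 * (E + h) * I ^ 2 + μ ^ 2)) :=
      Continuous.div (by fun_prop) (by fun_prop) fun I => (Real.sqrt_pos.2 (by positivity)).ne'
    exact ((Real.continuous_arccos.comp hq).const_mul 2).sub continuous_const
  exact hc.continuousOn.congr fun I hI => by simp [thetaI, Set.mem_Ioi.1 hI]

theorem thetaE_le_pi_div_two {E ω I : ℝ} (hI : 0 < I) (hE : 2 * I ^ 2 ≤ E) :
    thetaE E ω I ≤ Real.pi / 2 := by
  simp only [thetaE, if_pos hI]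
  exact arccot_le_pi_div_two (div_nonneg (by linarith) (by positivity))

theorem three_pi_div_four_le_thetaE {E ω I : ℝ} (hI : 0 < I) (hc : I ^ 2 < E - ω ^ 2 / 2)
    (hE : E ≤ 2 * I ^ 2)
    (hsq : I ^ 2 * (4 * E - 2 * (2 * I ^ 2 + ω ^ 2)) ≤ (2 * I ^ 2 - E) ^ 2) :
    3 * Real.pi / 4 ≤ thetaE E ω I := by
  simp only [thetaE, if_pos hI]
  have hd : 0 < 4 * E - 2 * (2 * I ^ 2 + ω ^ 2) := by linarith
  apply three_pi_div_four_le_arccot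
  rw [div_le_iff₀ (mul_pos hI (Real.sqrt_pos.2 hd))]
  have : I * Real.sqrt (4 * E - 2 * (2 * I ^ 2 + ω ^ 2)) ≤ 2 * I ^ 2 - E := by
    apply abs_le_of_sq_le_sq' _ (by linarith) |>.2
    rwa [mul_pow, Real.sq_sqrt hd.le]
  linarith

theorem thetaI_le_neg_pi_div_two {E h μ I : ℝ} (hI : 0 < I) (hd : 0 < 4 * (E + h) * I ^ 2 + μ ^ 2)
    (hsq : 2 * (2 * I ^ 2 - μ) ^ 2 ≤ 4 * (E + h) * I ^ 2 + μ ^ 2) :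
    thetaI E h μ I ≤ -(Real.pi / 2) := by
  simp only [thetaI, if_pos hI]
  have hs := Real.sqrt_pos.2 hd
  have hx : -(Real.sqrt 2 / 2) ≤ (2 * I ^ 2 - μ) / Real.sqrt (4 * (E + h) * I ^ 2 + μ ^ 2) := by
    apply (abs_le_of_sq_le_sq' _ (by positivity)).1
    rw [div_pow, Real.sq_sqrt hd.le, div_pow, Real.sq_sqrt (by norm_num), div_le_iff₀ hd]
    linarith
  have hcos := Real.arccos_le_arccos hx
  rw [Real.arccos_neg, ← Real.cos_pi_div_four,
    Real.arccos_cos (by positivity) (by linarith [Real.pi_pos])] at hcos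
  linarith

theorem neg_two_pi_div_three_le_thetaI {E h μ I : ℝ} (hI : 0 < I)
    (hd : 0 < 4 * (E + h) * I ^ 2 + μ ^ 2) (hμ : 2 * I ^ 2 ≤ μ)
    (hsq : 4 * (E + h) * I ^ 2 + μ ^ 2 ≤ 4 * (μ - 2 * I ^ 2) ^ 2) :
    -(2 * Real.pi / 3) ≤ thetaI E h μ I := by
  simp only [thetaI, if_pos hI]
  have hx : (2 * I ^ 2 - μ) / Real.sqrt (4 * (E + h) * I ^ 2 + μ ^ 2) ≤ -(1 / 2) := by
    rw [div_le_iff₀ (Real.sqrt_pos.2 hd)]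
    have : Real.sqrt (4 * (E + h) * I ^ 2 + μ ^ 2) ≤ 2 * (μ - 2 * I ^ 2) :=
      Real.sqrt_le_iff.2 ⟨by linarith, by linarith⟩
    linarith
  have hcos := Real.arccos_le_arccos hx
  rw [Real.arccos_neg, ← Real.cos_pi_div_three,
    Real.arccos_cos (by positivity) (by linarith [Real.pi_pos])] at hcos
  linarith

/-- For an open set of physical parameters `(𝓔, ω, μ, h)`, the circular first return
map admits non-homothetic fixed points: a pair `(ξ, ±I)` with `I ≠ 0` whose total
angular shift is a multiple of `2π`. -/
theorem circular_billiard_nonhomothetic_fixed_points :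
    ∃ U : Set (ℝ × ℝ × ℝ × ℝ), IsOpen U ∧ U.Nonempty ∧
      ∀ P ∈ U,
        0 < P.1 ∧ 0 < P.2.1 ∧ 0 < P.2.2.1 ∧ 0 < P.2.2.2 ∧ P.2.1 ^ 2 / 2 < P.1 ∧
        ∃ I ∈ Set.Ioo 0 (Real.sqrt (P.1 - P.2.1 ^ 2 / 2)), ∃ k : ℤ,
          thetaE P.1 P.2.1 I + thetaI P.1 P.2.2.2 P.2.2.1 I = 2 * Real.pi * (k : ℝ) ∧
          thetaE P.1 P.2.1 (-I) + thetaI P.1 P.2.2.2 P.2.2.1 (-I) = 2 * Real.pi * (-k : ℝ) := by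
  refine ⟨{P | 0 < P.2.1 ∧ 0 < P.2.2.2 ∧
      2 * (7 / 10 : ℝ) ^ 2 < P.1 ∧ P.1 < 2 * (19 / 20 : ℝ) ^ 2 ∧
      (19 / 20 : ℝ) ^ 2 < P.1 - P.2.1 ^ 2 / 2 ∧
      (19 / 20 : ℝ) ^ 2 * (4 * P.1 - 2 * (2 * (19 / 20 : ℝ) ^ 2 + P.2.1 ^ 2)) <
        (2 * (19 / 20 : ℝ) ^ 2 - P.1) ^ 2 ∧
      2 * (2 * (7 / 10 : ℝ) ^ 2 - P.2.2.1) ^ 2 <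
        4 * (P.1 + P.2.2.2) * (7 / 10 : ℝ) ^ 2 + P.2.2.1 ^ 2 ∧
      2 * (19 / 20 : ℝ) ^ 2 < P.2.2.1 ∧
      4 * (P.1 + P.2.2.2) * (19 / 20 : ℝ) ^ 2 + P.2.2.1 ^ 2 <
        4 * (P.2.2.1 - 2 * (19 / 20 : ℝ) ^ 2) ^ 2}, ?_, ⟨(1, 1 / 10, 5, 3), by norm_num⟩, ?_⟩
  · repeat' apply IsOpen.and
    all_goals exact isOpen_lt (by fun_prop) (by fun_prop)
  rintro ⟨E, ω, μ, h⟩ ⟨hω, hh, hE₀, hE₁, hc, hsqE, hsqI₀, hμ₁, hsqI₁⟩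
  dsimp only at *
  have hE : 0 < E := by linarith
  have hμ : 0 < μ := by linarith
  refine ⟨hE, hω, hμ, hh, by linarith, ?_⟩
  have hcont : ContinuousOn (fun I => thetaE E ω I + thetaI E h μ I)
      (Set.Icc (7 / 10) (19 / 20)) := by
    refine ((continuousOn_thetaE E ω).mono fun I hI => ?_).add
      ((continuousOn_thetaI (by positivity) hμ).mono fun I hI => ?_)
    · have hI₀ : 0 < I := by linarith [hI.1]
      exact ⟨hI₀, (pow_le_pow_left₀ hI₀.le hI.2 2).trans_lt hc⟩
    · exact Set.mem_Ioi.2 (by linarith [hI.1])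
  have hlow : thetaE E ω (7 / 10) + thetaI E h μ (7 / 10) ≤ 0 := by
    have h₁ := thetaE_le_pi_div_two (ω := ω) (by norm_num) hE₀.le
    have h₂ := thetaI_le_neg_pi_div_two (by norm_num) (by positivity) hsqI₀.le
    linarith
  have hhigh : 0 ≤ thetaE E ω (19 / 20) + thetaI E h μ (19 / 20) := by
    have h₁ := three_pi_div_four_le_thetaE (by norm_num) hc hE₁.le hsqE.le
    have h₂ := neg_two_pi_div_three_le_thetaI (by norm_num) (by positivity) hμ₁.le hsqI₁.le
    linarith [Real.pi_pos]
  obtain ⟨I, hI, hzero⟩ := intermediate_value_Icc (by norm_num) hcont ⟨hlow, hhigh⟩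
  have hI₀ : 0 < I := by linarith [hI.1]
  refine ⟨I, ⟨hI₀, Real.lt_sqrt_of_sq_lt ((pow_le_pow_left₀ hI₀.le hI.2 2).trans_lt hc)⟩, 0, ?_, ?_⟩
  · simpa using hzero
  · rw [thetaE_neg, thetaI_neg]
    simp only [Int.cast_zero, neg_zero, mul_zero]
    linarith
end

section
/- The inner angular shift θ_I of the circular refraction billiard is differentiable at every I ∈ (−I_c, I_c) and satisfies θ_I'(I) < 0 for all I ∈ (−I_c, I_c); in particular θ_I is strictly decreasing on (−I_c, I_c). -/
/-- The squared sine of the angle whose cosine is the argument of `arccos` in `thetaI`. -/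
theorem one_sub_cos_thetaI_sq {A μ I : ℝ} (hA : 0 < A) (hμ : 0 < μ) :
    1 - ((2 * I ^ 2 - μ) / Real.sqrt (4 * A * I ^ 2 + μ ^ 2)) ^ 2 =
      4 * I ^ 2 * (A + μ - I ^ 2) / (4 * A * I ^ 2 + μ ^ 2) := by
  have hR : 0 < 4 * A * I ^ 2 + μ ^ 2 := by positivity
  rw [div_pow, Real.sq_sqrt hR.le]
  field_simp
  ring

theorem hasDerivAt_cos_thetaI {A μ : ℝ} (I : ℝ) (hA : 0 < A) (hμ : 0 < μ) :
    HasDerivAt (fun x : ℝ => (2 * x ^ 2 - μ) / Real.sqrt (4 * A * x ^ 2 + μ ^ 2))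
      (4 * I * (2 * A * I ^ 2 + μ ^ 2 + μ * A) / Real.sqrt (4 * A * I ^ 2 + μ ^ 2) ^ 3) I := by
  have hR : 0 < 4 * A * I ^ 2 + μ ^ 2 := by positivity
  have hs : 0 < Real.sqrt (4 * A * I ^ 2 + μ ^ 2) := Real.sqrt_pos.2 hR
  have hsq := Real.sq_sqrt hR.le
  have h1 : HasDerivAt (fun x : ℝ => 2 * x ^ 2 - μ) (4 * I) I := by
    refine (((hasDerivAt_pow 2 I).const_mul 2).sub_const μ).congr_deriv ?_
    norm_num
    ring
  have h2 : HasDerivAt (fun x : ℝ => 4 * A * x ^ 2 + μ ^ 2) (8 * A * I) I := by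
    refine (((hasDerivAt_pow 2 I).const_mul (4 * A)).add_const (μ ^ 2)).congr_deriv ?_
    norm_num
    ring
  refine (h1.div (h2.sqrt hR.ne') hs.ne').congr_deriv ?_
  generalize Real.sqrt (4 * A * I ^ 2 + μ ^ 2) = s at *
  field_simp
  rw [hsq]
  ring

theorem exists_hasDerivAt_thetaI_of_pos {E h μ I : ℝ} (hA : 0 < E + h) (hμ : 0 < μ) (hI : 0 < I)
    (hIA : I ^ 2 < E + h + μ) : ∃ d < 0, HasDerivAt (thetaI E h μ) d I := by
  have hR : 0 < 4 * (E + h) * I ^ 2 + μ ^ 2 := by positivity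
  have hs : 0 < Real.sqrt (4 * (E + h) * I ^ 2 + μ ^ 2) := Real.sqrt_pos.2 hR
  have hpos : 0 < 1 - ((2 * I ^ 2 - μ) / Real.sqrt (4 * (E + h) * I ^ 2 + μ ^ 2)) ^ 2 := by
    rw [one_sub_cos_thetaI_sq hA hμ]
    have : 0 < E + h + μ - I ^ 2 := by linarith
    positivity
  have hd := hasDerivAt_cos_thetaI I hA hμ
  have hne1 : (2 * I ^ 2 - μ) / Real.sqrt (4 * (E + h) * I ^ 2 + μ ^ 2) ≠ -1 := by
    intro h1
    norm_num [h1] at hpos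
  have hne2 : (2 * I ^ 2 - μ) / Real.sqrt (4 * (E + h) * I ^ 2 + μ ^ 2) ≠ 1 := by
    intro h1
    norm_num [h1] at hpos
  refine ⟨_, ?_, ((((Real.hasDerivAt_arccos hne1 hne2).comp I hd).const_mul 2).sub_const
    (2 * Real.pi)).congr_of_eventuallyEq ?_⟩
  · have : 0 < Real.sqrt (1 - ((2 * I ^ 2 - μ) / Real.sqrt (4 * (E + h) * I ^ 2 + μ ^ 2)) ^ 2) :=
      Real.sqrt_pos.2 hpos
    rw [neg_mul, mul_neg, neg_lt_zero]
    positivity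
  · filter_upwards [lt_mem_nhds hI] with x hx
    simp [thetaI, hx]

theorem thetaI_eq_arcsin {E h μ I : ℝ} (hA : 0 < E + h) (hμ : 0 < μ) (hI : 2 * I ^ 2 ≤ μ) :
    thetaI E h μ I = -2 * Real.arcsin
      (2 * I * Real.sqrt (E + h + μ - I ^ 2) / Real.sqrt (4 * (E + h) * I ^ 2 + μ ^ 2)) := by
  have key : ∀ x : ℝ, 0 < x → 2 * x ^ 2 ≤ μ → thetaI E h μ x = -2 * Real.arcsin
      (2 * x * Real.sqrt (E + h + μ - x ^ 2) / Real.sqrt (4 * (E + h) * x ^ 2 + μ ^ 2)) := by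
    intro x hx hxμ
    have hR : 0 < 4 * (E + h) * x ^ 2 + μ ^ 2 := by positivity
    have hc : 0 ≤ -((2 * x ^ 2 - μ) / Real.sqrt (4 * (E + h) * x ^ 2 + μ ^ 2)) := by
      rw [← neg_div]
      exact div_nonneg (by linarith) (Real.sqrt_nonneg _)
    have harc := Real.arccos_eq_arcsin hc
    rw [Real.arccos_neg, neg_sq, one_sub_cos_thetaI_sq hA hμ, Real.sqrt_div' _ hR.le,
      Real.sqrt_mul (by positivity), show 4 * x ^ 2 = (2 * x) ^ 2 by ring,
      Real.sqrt_sq (by positivity)] at harc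
    rw [← harc]
    simp only [thetaI, hx, if_true]
    ring
  rcases lt_trichotomy I 0 with hneg | rfl | hpos
  · have := key (-I) (by linarith) (by simpa using hI)
    rw [thetaI_neg, neg_sq, mul_neg, neg_mul (2 * I), neg_div, Real.arcsin_neg] at this
    linarith
  · simp [thetaI]
  · exact key I hpos hI

theorem exists_hasDerivAt_thetaI_zero {E h μ : ℝ} (hA : 0 < E + h) (hμ : 0 < μ) :
    ∃ d < 0, HasDerivAt (thetaI E h μ) d 0 := by
  have hg : DifferentiableAt ℝ (fun x : ℝ => 2 * Real.sqrt (E + h + μ - x ^ 2) /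
      Real.sqrt (4 * (E + h) * x ^ 2 + μ ^ 2)) 0 := by
    refine DifferentiableAt.div ?_ ?_ ?_
    · exact (DifferentiableAt.sqrt (by fun_prop) (by norm_num; positivity)).const_mul 2
    · exact DifferentiableAt.sqrt (by fun_prop) (by norm_num; positivity)
    · norm_num [Real.sqrt_sq hμ.le]
      positivity
  have hd := (hasDerivAt_id (0 : ℝ)).mul hg.hasDerivAt
  have harc : HasDerivAt Real.arcsin 1 0 := by
    simpa using Real.hasDerivAt_arcsin (x := 0) (by norm_num) (by norm_num)
  have hcomp := (HasDerivAt.comp_of_eq (0 : ℝ) harc hd (by simp)).const_mul (-2)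
  refine ⟨_, ?_, hcomp.congr_of_eventuallyEq ?_⟩
  · have : 0 < Real.sqrt (E + h + μ) := Real.sqrt_pos.2 (by positivity)
    simp [Real.sqrt_sq hμ.le]
    positivity
  · have : ∀ᶠ x : ℝ in nhds 0, 2 * x ^ 2 < μ :=
      (show Continuous fun x : ℝ => 2 * x ^ 2 by fun_prop).continuousAt.eventually_lt
        continuousAt_const (by simpa using hμ)
    filter_upwards [this] with x hx
    rw [thetaI_eq_arcsin hA hμ hx.le]
    simp only [Function.comp_apply, Pi.mul_apply, id]
    congr 2
    ring

theorem exists_hasDerivAt_thetaI {E h μ I : ℝ} (hA : 0 < E + h) (hμ : 0 < μ)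
    (hIA : I ^ 2 < E + h + μ) : ∃ d < 0, HasDerivAt (thetaI E h μ) d I := by
  rcases lt_trichotomy I 0 with hI | rfl | hI
  · obtain ⟨d, hd, hder⟩ := exists_hasDerivAt_thetaI_of_pos (I := -I) hA hμ (by linarith)
      (by simpa using hIA)
    refine ⟨d, hd, ?_⟩
    have hodd : thetaI E h μ = fun x => -thetaI E h μ (-x) := by
      funext x
      rw [thetaI_neg, neg_neg]
    rw [hodd]
    exact (hder.comp I (hasDerivAt_neg I)).neg.congr_deriv (by ring)
  · exact exists_hasDerivAt_thetaI_zero hA hμ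
  · exact exists_hasDerivAt_thetaI_of_pos hA hμ hI hIA

/-- The inner angular shift `θ_I` is differentiable with negative derivative on
`(−I_c, I_c)`; in particular it is strictly decreasing there. -/
theorem thetaI_strictly_decreasing
    (E ω μ h : ℝ) (hE : 0 < E) (hω : 0 < ω) (hμ : 0 < μ) (hh : 0 < h)
    (hEω : ω ^ 2 / 2 < E) :
    (∀ I ∈ Set.Ioo (-Real.sqrt (E - ω ^ 2 / 2)) (Real.sqrt (E - ω ^ 2 / 2)),
        DifferentiableAt ℝ (thetaI E h μ) I ∧ deriv (thetaI E h μ) I < 0) ∧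
    StrictAntiOn (thetaI E h μ)
      (Set.Ioo (-Real.sqrt (E - ω ^ 2 / 2)) (Real.sqrt (E - ω ^ 2 / 2))) := by
  have hderiv : ∀ I ∈ Set.Ioo (-Real.sqrt (E - ω ^ 2 / 2)) (Real.sqrt (E - ω ^ 2 / 2)),
      DifferentiableAt ℝ (thetaI E h μ) I ∧ deriv (thetaI E h μ) I < 0 := by
    intro I hI
    have hsq : I ^ 2 < E - ω ^ 2 / 2 := by
      have := sq_lt_sq' hI.1 hI.2
      rwa [Real.sq_sqrt (by linarith)] at this
    obtain ⟨d, hd, hder⟩ := exists_hasDerivAt_thetaI (E := E) (h := h) (I := I)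
      (by linarith) hμ (by nlinarith [sq_nonneg ω])
    exact ⟨hder.differentiableAt, hder.deriv ▸ hd⟩
  refine ⟨hderiv, strictAntiOn_of_deriv_neg (convex_Ioo _ _)
    (fun I hI => (hderiv I hI).1.continuousAt.continuousWithinAt) fun I hI => ?_⟩
  rw [interior_Ioo] at hI
  exact (hderiv I hI).2
end

section
/- The angular shift of the circular refraction billiard is a C¹ function of the action: both θ_E and θ_I, defined piecewise for I > 0, I = 0 and I < 0, are continuously differentiable on the whole interval (−I_c, I_c) (in particular they are differentiable at I = 0, where θ_E(0) = θ_I(0) = 0). -/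
theorem thetaE_eventuallyEq_arctan {E : ℝ} (ω : ℝ) (hE : 0 < E) (hEω : ω ^ 2 / 2 < E) :
    thetaE E ω =ᶠ[nhds 0] fun I =>
      Real.arctan (I * Real.sqrt (4 * E - 2 * (2 * I ^ 2 + ω ^ 2)) / (E - 2 * I ^ 2)) := by
  have h1 : ∀ᶠ I : ℝ in nhds 0, 0 < E - 2 * I ^ 2 :=
    ContinuousAt.eventually_lt (by fun_prop) (by fun_prop) (by simpa using hE)
  have h2 : ∀ᶠ I : ℝ in nhds 0, 0 < 4 * E - 2 * (2 * I ^ 2 + ω ^ 2) :=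
    ContinuousAt.eventually_lt (by fun_prop) (by fun_prop) (by norm_num; linarith)
  filter_upwards [h1, h2] with I hx hs
  have hs' := Real.sqrt_pos.2 hs
  simp only [thetaE, arccot]
  rw [← inv_div (E - 2 * I ^ 2)]
  rcases lt_trichotomy I 0 with hI | rfl | hI
  · rw [if_neg hI.not_gt, if_pos hI, Real.arctan_inv_of_neg
      (div_neg_of_pos_of_neg hx (mul_neg_of_neg_of_pos hI hs'))]
    ring
  · simp
  · rw [if_pos hI, Real.arctan_inv_of_pos (div_pos hx (mul_pos hI hs'))]

theorem contDiffAt_thetaE {E ω I : ℝ} (hE : 0 < E) (hEω : ω ^ 2 / 2 < E)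
    (hI : I ^ 2 < E - ω ^ 2 / 2) : ContDiffAt ℝ 1 (thetaE E ω) I := by
  have hs : 4 * E - 2 * (2 * I ^ 2 + ω ^ 2) ≠ 0 := by linarith
  have hsqrt : ContDiffAt ℝ 1
      (fun I : ℝ => Real.sqrt (4 * E - 2 * (2 * I ^ 2 + ω ^ 2))) I :=
    ContDiffAt.sqrt (by fun_prop) hs
  have hs0 : Real.sqrt (4 * E - 2 * (2 * I ^ 2 + ω ^ 2)) ≠ 0 :=
    (Real.sqrt_pos.2 (by linarith)).ne'
  rcases eq_or_ne I 0 with rfl | h0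
  · refine ContDiffAt.congr_of_eventuallyEq ?_ (thetaE_eventuallyEq_arctan ω hE hEω)
    exact ((contDiffAt_id.mul hsqrt).div (by fun_prop) (by simpa using hE.ne')).arctan
  have hc : ContDiffAt ℝ 1 (fun I : ℝ => arccot ((E - 2 * I ^ 2) /
      (I * Real.sqrt (4 * E - 2 * (2 * I ^ 2 + ω ^ 2))))) I :=
    contDiffAt_const.sub (ContDiffAt.div (by fun_prop) (contDiffAt_id.mul hsqrt)
      (mul_ne_zero h0 hs0)).arctan
  rcases h0.lt_or_gt with hneg | hpos
  · refine (hc.sub (contDiffAt_const (c := Real.pi))).congr_of_eventuallyEq ?_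
    filter_upwards [eventually_lt_nhds hneg] with J hJ
    simp [thetaE, hJ, hJ.not_gt]
  · refine hc.congr_of_eventuallyEq ?_
    filter_upwards [eventually_gt_nhds hpos] with J hJ
    simp [thetaE, hJ]

theorem one_sub_sq_thetaI_arg {a μ I : ℝ} (hD : 0 < 4 * a * I ^ 2 + μ ^ 2) :
    1 - ((2 * I ^ 2 - μ) / Real.sqrt (4 * a * I ^ 2 + μ ^ 2)) ^ 2 =
      (2 * I) ^ 2 * (a + μ - I ^ 2) / (4 * a * I ^ 2 + μ ^ 2) := by
  rw [div_pow, Real.sq_sqrt hD.le, eq_div_iff hD.ne', sub_mul, div_mul_cancel₀ _ hD.ne']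
  ring

theorem thetaI_eventuallyEq_arcsin {E h μ : ℝ} (ha : 0 < E + h) (hμ : 0 < μ) :
    thetaI E h μ =ᶠ[nhds 0] fun I =>
      -2 * Real.arcsin (2 * I * Real.sqrt (E + h + μ - I ^ 2) /
        Real.sqrt (4 * (E + h) * I ^ 2 + μ ^ 2)) := by
  have h1 : ∀ᶠ I : ℝ in nhds 0, 2 * I ^ 2 - μ < 0 :=
    ContinuousAt.eventually_lt (by fun_prop) (by fun_prop) (by simpa using hμ)
  filter_upwards [h1] with I hu
  have hD : 0 < 4 * (E + h) * I ^ 2 + μ ^ 2 := by positivity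
  set v := (2 * I ^ 2 - μ) / Real.sqrt (4 * (E + h) * I ^ 2 + μ ^ 2) with hv
  have hv0 : 0 ≤ -v := neg_nonneg.2 (div_nonpos_of_nonpos_of_nonneg hu.le (Real.sqrt_nonneg _))
  have key : Real.arccos v = Real.pi - Real.arcsin (2 * |I| * Real.sqrt (E + h + μ - I ^ 2) /
      Real.sqrt (4 * (E + h) * I ^ 2 + μ ^ 2)) := by
    rw [← neg_neg v, Real.arccos_neg, Real.arccos_eq_arcsin hv0, neg_sq, hv,
      one_sub_sq_thetaI_arg hD, Real.sqrt_div' _ hD.le, Real.sqrt_mul (sq_nonneg _),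
      Real.sqrt_sq_eq_abs, abs_mul, abs_two]
  simp only [thetaI, ← hv, key]
  rcases lt_trichotomy I 0 with hI | rfl | hI
  · rw [if_neg hI.not_gt, if_pos hI, abs_of_neg hI, mul_neg, neg_mul, neg_div, Real.arcsin_neg]
    ring
  · simp
  · rw [if_pos hI, abs_of_pos hI]
    ring

theorem contDiffAt_thetaI {E h μ I : ℝ} (ha : 0 < E + h) (hμ : 0 < μ)
    (hI : I ^ 2 < E + h + μ) : ContDiffAt ℝ 1 (thetaI E h μ) I := by
  have hD : 0 < 4 * (E + h) * I ^ 2 + μ ^ 2 := by positivity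
  have hsqrt : ContDiffAt ℝ 1 (fun I : ℝ => Real.sqrt (4 * (E + h) * I ^ 2 + μ ^ 2)) I :=
    ContDiffAt.sqrt (by fun_prop) hD.ne'
  have hs0 := (Real.sqrt_pos.2 hD).ne'
  rcases eq_or_ne I 0 with rfl | h0
  · refine ContDiffAt.congr_of_eventuallyEq ?_ (thetaI_eventuallyEq_arcsin ha hμ)
    have hnum : ContDiffAt ℝ 1 (fun I : ℝ => 2 * I * Real.sqrt (E + h + μ - I ^ 2)) 0 :=
      ContDiffAt.mul (by fun_prop) (ContDiffAt.sqrt (by fun_prop) (by linarith))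
    exact contDiffAt_const.mul
      ((Real.contDiffAt_arcsin (by simp) (by simp)).comp (0 : ℝ) (hnum.div hsqrt hs0))
  have hv : ((2 * I ^ 2 - μ) / Real.sqrt (4 * (E + h) * I ^ 2 + μ ^ 2)) ^ 2 < 1 := by
    rw [← sub_pos, one_sub_sq_thetaI_arg hD]
    have := sub_pos.2 hI
    positivity
  have hv' := abs_lt.1 ((sq_lt_one_iff_abs_lt_one _).1 hv)
  have hnum : ContDiffAt ℝ 1 (fun I : ℝ => 2 * I ^ 2 - μ) I := by fun_prop
  have hc : ContDiffAt ℝ 1 (fun I : ℝ => 2 * Real.arccos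
      ((2 * I ^ 2 - μ) / Real.sqrt (4 * (E + h) * I ^ 2 + μ ^ 2))) I :=
    contDiffAt_const.mul (ContDiffAt.comp (g := Real.arccos) I (Real.contDiffAt_arccos hv'.1.ne' hv'.2.ne)
      (hnum.div hsqrt hs0))
  rcases h0.lt_or_gt with hneg | hpos
  · refine (hc.neg.add (contDiffAt_const (c := 2 * Real.pi))).congr_of_eventuallyEq ?_
    filter_upwards [eventually_lt_nhds hneg] with J hJ
    simp [thetaI, hJ, hJ.not_gt]
  · refine (hc.sub (contDiffAt_const (c := 2 * Real.pi))).congr_of_eventuallyEq ?_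
    filter_upwards [eventually_gt_nhds hpos] with J hJ
    simp [thetaI, hJ]

/-- The angular shifts `θ_E` and `θ_I` of the circular refraction billiard are `C¹`
functions of the action on the whole interval `(−I_c, I_c)`; in particular they are
differentiable at `I = 0`, where both vanish. -/
theorem shifts_are_C1
    (E ω μ h : ℝ) (hE : 0 < E) (hω : 0 < ω) (hμ : 0 < μ) (hh : 0 < h)
    (hEω : ω ^ 2 / 2 < E) :
    ContDiffOn ℝ 1 (thetaE E ω)
        (Set.Ioo (-Real.sqrt (E - ω ^ 2 / 2)) (Real.sqrt (E - ω ^ 2 / 2))) ∧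
    ContDiffOn ℝ 1 (thetaI E h μ)
        (Set.Ioo (-Real.sqrt (E - ω ^ 2 / 2)) (Real.sqrt (E - ω ^ 2 / 2))) ∧
    DifferentiableAt ℝ (thetaE E ω) 0 ∧ DifferentiableAt ℝ (thetaI E h μ) 0 ∧
    thetaE E ω 0 = 0 ∧ thetaI E h μ 0 = 0 := by
  have hc : 0 < E - ω ^ 2 / 2 := sub_pos.2 hEω
  have hsq : ∀ I ∈ Set.Ioo (-Real.sqrt (E - ω ^ 2 / 2)) (Real.sqrt (E - ω ^ 2 / 2)),
      I ^ 2 < E - ω ^ 2 / 2 := fun I hI => Real.sq_lt.2 hI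
  have ha : 0 < E + h := add_pos hE hh
  refine ⟨fun I hI => (contDiffAt_thetaE hE hEω (hsq I hI)).contDiffWithinAt,
    fun I hI => (contDiffAt_thetaI ha hμ ?_).contDiffWithinAt,
    (contDiffAt_thetaE hE hEω (by simpa using hc)).differentiableAt one_ne_zero,
    (contDiffAt_thetaI ha hμ (by rw [zero_pow two_ne_zero]; positivity)).differentiableAt
      one_ne_zero, by simp [thetaE], by simp [thetaI]⟩
  have := hsq I hI
  have := sq_nonneg ω
  linarith
end

section
/- The set 𝒥 = {I ∈ (−I_c, I_c) : θ_E'(I) + θ_I'(I) = 0} of critical points of the total angular shift θ_E + θ_I of the circular refraction billiard is finite. -/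
theorem hasDerivAt_arccot (x : ℝ) : HasDerivAt arccot (-(1 / (1 + x ^ 2))) x :=
  (Real.hasDerivAt_arctan x).const_sub (Real.pi / 2)

theorem shiftDenom_pos {E ω I : ℝ} (hI : I ^ 2 < E - ω ^ 2 / 2) :
    0 < E ^ 2 - 2 * ω ^ 2 * I ^ 2 := by
  rcases eq_or_ne ω 0 with rfl | hω
  · have : 0 < E := by nlinarith [sq_nonneg I]
    have := pow_pos this 2
    linarith
  · have : 0 < ω ^ 2 := by positivity
    nlinarith [sq_nonneg (E - ω ^ 2)]

theorem hasDerivAt_thetaE_formula {E ω I : ℝ} (hI0 : I ≠ 0) (hI : I ^ 2 < E - ω ^ 2 / 2) :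
    HasDerivAt
      (fun I ↦ arccot ((E - 2 * I ^ 2) / (I * √(4 * E - 2 * (2 * I ^ 2 + ω ^ 2)))))
      (2 * (2 * E ^ 2 - E * ω ^ 2 - 2 * ω ^ 2 * I ^ 2) /
        (√(4 * E - 2 * (2 * I ^ 2 + ω ^ 2)) * (E ^ 2 - 2 * ω ^ 2 * I ^ 2))) I := by
  have hr : 0 < 4 * E - 2 * (2 * I ^ 2 + ω ^ 2) := by linarith
  have hQ := shiftDenom_pos hI
  have hsq : HasDerivAt (fun I : ℝ ↦ I ^ 2) (2 * I) I := by simpa using hasDerivAt_pow 2 I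
  have hN := (hsq.const_mul 2).const_sub E
  have hD := (hasDerivAt_id' I).mul
    (((((hsq.const_mul 2).add_const (ω ^ 2)).const_mul 2).const_sub (4 * E)).sqrt hr.ne')
  have hr' := Real.sqrt_pos.2 hr
  have hs := Real.sq_sqrt hr.le
  set r := √(4 * E - 2 * (2 * I ^ 2 + ω ^ 2))
  have hx := hN.div hD (mul_ne_zero hI0 hr'.ne')
  refine ((hasDerivAt_arccot _).comp I hx).congr_deriv ?_
  have hden : 1 + ((E - 2 * I ^ 2) / (I * r)) ^ 2 =
      (E ^ 2 - 2 * ω ^ 2 * I ^ 2) / (I * r) ^ 2 := by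
    field_simp
    rw [hs]
    ring
  change -(1 / (1 + ((E - 2 * I ^ 2) / (I * r)) ^ 2)) * ((-(2 * (2 * I)) * (I * r) -
    (E - 2 * I ^ 2) * (1 * r + I * (-(2 * (2 * (2 * I))) / (2 * r)))) / (I * r) ^ 2) = _
  rw [hden]
  field_simp
  rw [hs]
  ring

theorem hasDerivAt_thetaE {E ω I : ℝ} (hI0 : I ≠ 0) (hI : I ^ 2 < E - ω ^ 2 / 2) :
    HasDerivAt (thetaE E ω)
      (2 * (2 * E ^ 2 - E * ω ^ 2 - 2 * ω ^ 2 * I ^ 2) /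
        (√(4 * E - 2 * (2 * I ^ 2 + ω ^ 2)) * (E ^ 2 - 2 * ω ^ 2 * I ^ 2))) I := by
  have key := hasDerivAt_thetaE_formula hI0 hI
  rcases hI0.lt_or_gt with hneg | hpos
  · refine (key.sub_const Real.pi).congr_of_eventuallyEq ?_
    filter_upwards [Iio_mem_nhds hneg] with J (hJ : J < 0)
    simp [thetaE, hJ, hJ.not_gt]
  · refine key.congr_of_eventuallyEq ?_
    filter_upwards [Ioi_mem_nhds hpos] with J (hJ : 0 < J)
    simp [thetaE, hJ]

theorem hasDerivAt_thetaI_formula {a μ I : ℝ} (ha : 0 < a) (hI0 : I ≠ 0)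
    (hI : I ^ 2 < a + μ) :
    HasDerivAt (fun I ↦ Real.arccos ((2 * I ^ 2 - μ) / √(4 * a * I ^ 2 + μ ^ 2)))
      (-(2 * I * (2 * a * I ^ 2 + μ ^ 2 + a * μ) /
        (|I| * (4 * a * I ^ 2 + μ ^ 2) * √(a + μ - I ^ 2)))) I := by
  have hR : 0 < 4 * a * I ^ 2 + μ ^ 2 := by positivity
  have hsq : HasDerivAt (fun I : ℝ ↦ I ^ 2) (2 * I) I := by simpa using hasDerivAt_pow 2 I
  have hN := (hsq.const_mul 2).sub_const μ
  have hD := ((hsq.const_mul (4 * a)).add_const (μ ^ 2)).sqrt hR.ne'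
  have hR' := Real.sqrt_pos.2 hR
  have hs := Real.sq_sqrt hR.le
  have ht := Real.sqrt_pos.2 (sub_pos.2 hI)
  have hts := Real.sq_sqrt (sub_pos.2 hI).le
  have habs := abs_pos.2 hI0
  have hy := hN.div hD hR'.ne'
  rw [← hs]
  set R := √(4 * a * I ^ 2 + μ ^ 2)
  set t := √(a + μ - I ^ 2)
  have hsq_eq : 1 - ((2 * I ^ 2 - μ) / R) ^ 2 = (2 * |I| * t / R) ^ 2 := by
    field_simp
    rw [sq_abs, hs, hts]
    ring
  have hpos : 0 < 2 * |I| * t / R := by positivity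
  have hlt : 0 < 1 - ((2 * I ^ 2 - μ) / R) ^ 2 := hsq_eq ▸ pow_pos hpos 2
  have h₁ : (2 * I ^ 2 - μ) / R ≠ -1 := fun h ↦ by norm_num [h] at hlt
  have h₂ : (2 * I ^ 2 - μ) / R ≠ 1 := fun h ↦ by norm_num [h] at hlt
  refine ((Real.hasDerivAt_arccos h₁ h₂).comp I hy).congr_deriv ?_
  rw [hsq_eq, Real.sqrt_sq hpos.le]
  change -(1 / (2 * |I| * t / R)) * ((2 * (2 * I) * R - (2 * I ^ 2 - μ) *
    (4 * a * (2 * I) / (2 * R))) / R ^ 2) = _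
  field_simp
  rw [hs]
  ring

theorem hasDerivAt_thetaI {E h μ I : ℝ} (ha : 0 < E + h) (hI0 : I ≠ 0)
    (hI : I ^ 2 < E + h + μ) :
    HasDerivAt (thetaI E h μ)
      (-(4 * (2 * (E + h) * I ^ 2 + μ ^ 2 + (E + h) * μ) /
        ((4 * (E + h) * I ^ 2 + μ ^ 2) * √(E + h + μ - I ^ 2)))) I := by
  have key := (hasDerivAt_thetaI_formula ha hI0 hI).const_mul 2
  have hR : 0 < 4 * (E + h) * I ^ 2 + μ ^ 2 := by positivity
  have ht := Real.sqrt_pos.2 (sub_pos.2 hI)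
  rcases hI0.lt_or_gt with hneg | hpos
  · refine ((key.neg.add_const (2 * Real.pi)).congr_of_eventuallyEq ?_).congr_deriv ?_
    · filter_upwards [Iio_mem_nhds hneg] with J (hJ : J < 0)
      simp [thetaI, hJ, hJ.not_gt]
    · rw [abs_of_neg hneg]
      field_simp
      ring
  · refine ((key.sub_const (2 * Real.pi)).congr_of_eventuallyEq ?_).congr_deriv ?_
    · filter_upwards [Ioi_mem_nhds hpos] with J (hJ : 0 < J)
      simp [thetaI, hJ]
    · rw [abs_of_pos hpos]
      field_simp
      ring

open Polynomial in
/-- A polynomial vanishing at the square of every nonzero critical point of the total shift,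
obtained by clearing denominators and square roots in the derivative. -/
noncomputable def shiftPoly (E ω μ h : ℝ) : ℝ[X] :=
  (C (2 * E ^ 2 - E * ω ^ 2) - C (2 * ω ^ 2) * X) ^ 2 * (C (4 * (E + h)) * X + C (μ ^ 2)) ^ 2 *
      (C (E + h + μ) - X) -
    16 * (C (2 * (E + h)) * X + C (μ ^ 2 + (E + h) * μ)) ^ 2 *
      (C (E ^ 2) - C (2 * ω ^ 2) * X) ^ 2 * (C (E - ω ^ 2 / 2) - X)

theorem eval_shiftPoly (E ω μ h u : ℝ) :
    (shiftPoly E ω μ h).eval u =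
      (2 * E ^ 2 - E * ω ^ 2 - 2 * ω ^ 2 * u) ^ 2 * (4 * (E + h) * u + μ ^ 2) ^ 2 *
          (E + h + μ - u) -
        16 * (2 * (E + h) * u + (μ ^ 2 + (E + h) * μ)) ^ 2 * (E ^ 2 - 2 * ω ^ 2 * u) ^ 2 *
          (E - ω ^ 2 / 2 - u) := by
  simp [shiftPoly]

theorem shiftPoly_ne_zero {E ω μ h : ℝ} (hE : 0 < E) (hμ : 0 < μ) (hh : 0 < h)
    (hEω : ω ^ 2 / 2 < E) : shiftPoly E ω μ h ≠ 0 := by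
  intro h0
  have hc := eval_shiftPoly E ω μ h (E - ω ^ 2 / 2)
  have hb := eval_shiftPoly E ω μ h (E + h + μ)
  rw [h0, Polynomial.eval_zero] at hc hb
  have hω := sq_nonneg ω
  have hc₀ : 0 < E - ω ^ 2 / 2 := by linarith
  have hR : 4 * (E + h) * (E - ω ^ 2 / 2) + μ ^ 2 ≠ 0 := by positivity
  have hB : 2 * (E + h) * (E + h + μ) + (μ ^ 2 + (E + h) * μ) ≠ 0 := by positivity
  have hbc : E + h + μ - (E - ω ^ 2 / 2) ≠ 0 := by
    have : 0 < E + h + μ - (E - ω ^ 2 / 2) := by linarith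
    exact this.ne'
  have hcb : E - ω ^ 2 / 2 - (E + h + μ) ≠ 0 := by
    rw [← neg_sub]; exact neg_ne_zero.2 hbc
  have hA : 2 * E ^ 2 - E * ω ^ 2 - 2 * ω ^ 2 * (E - ω ^ 2 / 2) = 0 := by
    simpa [hR, hbc] using hc.symm
  have hQ : E ^ 2 - 2 * ω ^ 2 * (E + h + μ) = 0 := by
    simpa [hB, hcb] using hb.symm
  have hEω' : E = ω ^ 2 := by
    have : (E - ω ^ 2 / 2) * (E - ω ^ 2) = 0 := by linear_combination hA / 2
    rcases mul_eq_zero.1 this with h | h <;> linarith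
  rw [← hEω'] at hQ
  nlinarith [mul_pos hE hh, mul_pos hE hμ, mul_pos hE hE]

theorem isRoot_shiftPoly {E ω μ h I : ℝ} (hE : 0 < E) (hμ : 0 < μ) (hh : 0 < h)
    (hI0 : I ≠ 0) (hI : I ^ 2 < E - ω ^ 2 / 2)
    (hcrit : deriv (thetaE E ω) I + deriv (thetaI E h μ) I = 0) :
    (shiftPoly E ω μ h).IsRoot (I ^ 2) := by
  have hI' : I ^ 2 < E + h + μ := by nlinarith [sq_nonneg ω]
  rw [(hasDerivAt_thetaE hI0 hI).deriv,
    (hasDerivAt_thetaI (by positivity) hI0 hI').deriv] at hcrit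
  have hr : 0 < 4 * E - 2 * (2 * I ^ 2 + ω ^ 2) := by linarith
  have hQ := shiftDenom_pos hI
  have hR : 0 < 4 * (E + h) * I ^ 2 + μ ^ 2 := by positivity
  have hr' := Real.sqrt_pos.2 hr
  have hrs := Real.sq_sqrt hr.le
  have ht' := Real.sqrt_pos.2 (sub_pos.2 hI')
  have hts := Real.sq_sqrt (sub_pos.2 hI').le
  set r := √(4 * E - 2 * (2 * I ^ 2 + ω ^ 2))
  set t := √(E + h + μ - I ^ 2)
  rw [← sub_eq_add_neg, sub_eq_zero, div_eq_div_iff (by positivity) (by positivity)] at hcrit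
  have hsq := congrArg (· ^ 2) hcrit
  simp only [mul_pow, hrs, hts] at hsq
  rw [Polynomial.IsRoot, eval_shiftPoly]
  linear_combination hsq / 4

/-- The set of critical points of the total angular shift `θ_E + θ_I` of the circular
refraction billiard in `(−I_c, I_c)` is finite. -/
theorem critical_set_of_total_shift_finite
    (E ω μ h : ℝ) (hE : 0 < E) (hω : 0 < ω) (hμ : 0 < μ) (hh : 0 < h)
    (hEω : ω ^ 2 / 2 < E) :
    Set.Finite {I : ℝ |
      I ∈ Set.Ioo (-Real.sqrt (E - ω ^ 2 / 2)) (Real.sqrt (E - ω ^ 2 / 2)) ∧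
      deriv (thetaE E ω) I + deriv (thetaI E h μ) I = 0} := by
  let P := (shiftPoly E ω μ h).comp (Polynomial.X ^ 2)
  have hP : P ≠ 0 := by
    intro h0
    rcases Polynomial.comp_eq_zero_iff.1 h0 with h | ⟨-, h⟩
    · exact shiftPoly_ne_zero hE hμ hh hEω h
    · simpa using congrArg Polynomial.natDegree h
  refine ((Polynomial.finite_setOfPred_isRoot hP).insert 0).subset ?_
  rintro I ⟨hI, hcrit⟩
  rcases eq_or_ne I 0 with rfl | hI0
  · exact Set.mem_insert _ _
  · right
    have := isRoot_shiftPoly hE hμ hh hI0 (Real.sq_lt.2 hI) hcrit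
    simpa [P, Polynomial.IsRoot] using this
end

section
/- Fix a non-circular elliptic shape with semi-axes a > b > 0. For Lebesgue-almost every translation vector c ∈ ℝ² such that the origin lies in the interior of the translated ellipse E_c = {c + (a cos ξ, b sin ξ) : ξ ∈ [0, 2π)} (i.e. c₁²/a² + c₂²/b² < 1), the translated elliptic domain is admissible: there exist ξ₁, ξ₂ ∈ [0, 2π) such that each ξᵢ is a strict local maximum or minimum of ξ ↦ |c + (a cos ξ, b sin ξ)|, the segment from the origin to c + (a cos ξᵢ, b sin ξᵢ) meets E_c only at that point, and the two vectors c + (a cos ξ₁, b sin ξ₁) and c + (a cos ξ₂, b sin ξ₂) are linearly independent. In other words, a fixed non-circular ellipse can be placed almost everywhere with respect to the origin (keeping the origin in its interior) so as to give an admissible domain. -/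
open MeasureTheory

/-- The Euclidean norm on `ℝ × ℝ`. -/
noncomputable def enorm2 (p : ℝ × ℝ) : ℝ := Real.sqrt (p.1 ^ 2 + p.2 ^ 2)

/-- The ellipse with semi-axes `a`, `b` translated by the vector `c`. -/
noncomputable def ellT (a b : ℝ) (c : ℝ × ℝ) (ξ : ℝ) : ℝ × ℝ :=
  (c.1 + a * Real.cos ξ, c.2 + b * Real.sin ξ)

/-- The squared Euclidean norm along the translated ellipse. -/
noncomputable def ellTNormSq (a b : ℝ) (c : ℝ × ℝ) (ξ : ℝ) : ℝ :=
  (c.1 + a * Real.cos ξ) ^ 2 + (c.2 + b * Real.sin ξ) ^ 2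

theorem enorm2_ellT_lt_iff (a b : ℝ) (c : ℝ × ℝ) (ξ η : ℝ) :
    enorm2 (ellT a b c ξ) < enorm2 (ellT a b c η) ↔
      ellTNormSq a b c ξ < ellTNormSq a b c η :=
  Real.sqrt_lt_sqrt_iff (by positivity)

theorem ellTNormSq_periodic (a b : ℝ) (c : ℝ × ℝ) :
    Function.Periodic (ellTNormSq a b c) (2 * Real.pi) := by
  intro ξ
  simp [ellTNormSq]

theorem analyticOnNhd_ellTNormSq (a b : ℝ) (c : ℝ × ℝ) :
    AnalyticOnNhd ℝ (ellTNormSq a b c) Set.univ := by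
  intro x _
  unfold ellTNormSq
  have h₁ : AnalyticAt ℝ Real.cos x := Real.analyticAt_cos
  have h₂ : AnalyticAt ℝ Real.sin x := Real.analyticAt_sin
  exact ((analyticAt_const.add (analyticAt_const.mul h₁)).pow 2).add
    ((analyticAt_const.add (analyticAt_const.mul h₂)).pow 2)

theorem hasDerivAt_ellTNormSq (a b : ℝ) (c : ℝ × ℝ) (ξ : ℝ) :
    HasDerivAt (ellTNormSq a b c)
      (2 * ((c.1 + a * Real.cos ξ) * (-(a * Real.sin ξ)) +
        (c.2 + b * Real.sin ξ) * (b * Real.cos ξ))) ξ := by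
  have h := ((((Real.hasDerivAt_cos ξ).const_mul a).const_add c.1).pow 2).add
    ((((Real.hasDerivAt_sin ξ).const_mul b).const_add c.2).pow 2)
  refine h.congr_deriv ?_
  simp
  ring

/-- A value of a nonconstant real-analytic function is not attained near, and different from,
a given point where it is attained. -/
theorem AnalyticOnNhd.exists_forall_ne_of_not_const {f : ℝ → ℝ} (hf : AnalyticOnNhd ℝ f Set.univ)
    {u v : ℝ} (huv : f u ≠ f v) (ξ : ℝ) :
    ∃ δ > 0, ∀ η : ℝ, η ≠ ξ → |η - ξ| < δ → f η ≠ f ξ := by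
  have hg : AnalyticOnNhd ℝ (fun x => f x - f ξ) Set.univ := fun x hx =>
    (hf x hx).sub analyticAt_const
  rcases (hg ξ trivial).eventually_eq_zero_or_eventually_ne_zero with h | h
  · have h0 := hg.eqOn_zero_of_preconnected_of_eventuallyEq_zero isPreconnected_univ
      (Set.mem_univ ξ) h
    have hu := h0 (Set.mem_univ u)
    have hv := h0 (Set.mem_univ v)
    simp only [Pi.zero_apply] at hu hv
    exact absurd (by linarith) huv
  · rw [eventually_nhdsWithin_iff, Metric.eventually_nhds_iff] at h
    obtain ⟨δ, hδ, h⟩ := h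
    exact ⟨δ, hδ, fun η hη hd => sub_ne_zero.1 (h (by rwa [Real.dist_eq]) hη)⟩

theorem Function.Periodic.exists_isMax_isMin {f : ℝ → ℝ} {T : ℝ} (hT : 0 < T)
    (hp : Function.Periodic f T) (hf : Continuous f) :
    (∃ x ∈ Set.Ico 0 T, ∀ y, f y ≤ f x) ∧ ∃ x ∈ Set.Ico 0 T, ∀ y, f x ≤ f y := by
  have hne : (Set.Icc 0 T).Nonempty := ⟨0, le_rfl, hT.le⟩
  obtain ⟨x, -, hx⟩ := isCompact_Icc.exists_isMaxOn hne hf.continuousOn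
  obtain ⟨z, -, hz⟩ := isCompact_Icc.exists_isMinOn hne hf.continuousOn
  obtain ⟨x', hx', hxx⟩ := hp.exists_mem_Ico₀ hT x
  obtain ⟨z', hz', hzz⟩ := hp.exists_mem_Ico₀ hT z
  refine ⟨⟨x', hx', fun y => ?_⟩, z', hz', fun y => ?_⟩ <;>
    obtain ⟨y', hy', hyy⟩ := hp.exists_mem_Ico₀ hT y
  · rw [hyy, ← hxx]
    exact hx (Set.Ico_subset_Icc_self hy')
  · rw [hyy, ← hzz]
    exact hz (Set.Ico_subset_Icc_self hy')

theorem segment_inter_range_ellT {a b : ℝ} (ha : 0 < a) (hb : 0 < b) {c : ℝ × ℝ}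
    (hc : c.1 ^ 2 / a ^ 2 + c.2 ^ 2 / b ^ 2 < 1) (ξ : ℝ) :
    segment ℝ (0 : ℝ × ℝ) (ellT a b c ξ) ∩ Set.range (ellT a b c) = {ellT a b c ξ} := by
  refine Set.Subset.antisymm ?_
    (Set.singleton_subset_iff.2 ⟨right_mem_segment ℝ _ _, Set.mem_range_self ξ⟩)
  rintro _ ⟨⟨s, t, hs, ht, hst, h⟩, η, rfl⟩
  have h1 := congrArg Prod.fst h
  have h2 := congrArg Prod.snd h
  simp [ellT] at h1 h2
  obtain ⟨p, hp⟩ : ∃ p, c.1 = a * p := ⟨c.1 / a, by field_simp⟩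
  obtain ⟨q, hq⟩ : ∃ q, c.2 = b * q := ⟨c.2 / b, by field_simp⟩
  have hpq : p ^ 2 + q ^ 2 < 1 := by
    rw [hp, hq] at hc
    convert hc using 2 <;> field_simp
  rw [hp] at h1
  rw [hq] at h2
  have e1 : Real.cos η = t * Real.cos ξ - s * p := by
    apply mul_left_cancel₀ ha.ne'
    obtain rfl : t = 1 - s := by linarith
    linarith
  have e2 : Real.sin η = t * Real.sin ξ - s * q := by
    apply mul_left_cancel₀ hb.ne'
    obtain rfl : t = 1 - s := by linarith
    linarith
  have hξ := Real.sin_sq_add_cos_sq ξ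
  have hη := Real.sin_sq_add_cos_sq η
  have hs0 : s = 0 := by
    by_contra hne
    have hspos : 0 < s := lt_of_le_of_ne hs (Ne.symm hne)
    have key : 1 ≤ t + s * (p ^ 2 + q ^ 2) := by
      have hid : t * (Real.sin ξ ^ 2 + Real.cos ξ ^ 2) + s * (p ^ 2 + q ^ 2)
          - (Real.sin η ^ 2 + Real.cos η ^ 2)
          = s * t * ((Real.cos ξ + p) ^ 2 + (Real.sin ξ + q) ^ 2) := by
        rw [e1, e2]
        obtain rfl : t = 1 - s := by linarith
        ring
      have : 0 ≤ s * t * ((Real.cos ξ + p) ^ 2 + (Real.sin ξ + q) ^ 2) := by positivity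
      rw [hξ, hη] at hid
      linarith
    nlinarith
  subst hs0
  obtain rfl : t = 1 := by linarith
  simpa using h.symm

theorem ellT_ne_zero {a b : ℝ} (ha : 0 < a) (hb : 0 < b) {c : ℝ × ℝ}
    (hc : c.1 ^ 2 / a ^ 2 + c.2 ^ 2 / b ^ 2 < 1) (ξ : ℝ) : ellT a b c ξ ≠ 0 := by
  intro h
  have h1 : c.1 + a * Real.cos ξ = 0 := congrArg Prod.fst h
  have h2 : c.2 + b * Real.sin ξ = 0 := congrArg Prod.snd h
  rw [eq_neg_of_add_eq_zero_left h1, eq_neg_of_add_eq_zero_left h2] at hc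
  have : (-(a * Real.cos ξ)) ^ 2 / a ^ 2 + (-(b * Real.sin ξ)) ^ 2 / b ^ 2 = 1 := by
    rw [← Real.cos_sq_add_sin_sq ξ]
    field_simp
  linarith

theorem linearIndependent_pair_of_det_ne_zero {x y : ℝ × ℝ} (h : x.1 * y.2 - x.2 * y.1 ≠ 0) :
    LinearIndependent ℝ ![x, y] := by
  rw [LinearIndependent.pair_iff]
  intro s t hst
  have h1 := congrArg Prod.fst hst
  have h2 := congrArg Prod.snd hst
  simp at h1 h2
  constructor <;> apply mul_right_cancel₀ h
  · linear_combination y.2 * h1 - y.1 * h2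
  · linear_combination x.1 * h2 - x.2 * h1

/-- Nonzero vectors of the plane that are each orthogonal to one of two directions
and are collinear have collinear directions. -/
theorem det_eq_zero_of_orthogonal {x₁ x₂ y₁ y₂ u₁ u₂ v₁ v₂ : ℝ} (hx : x₁ ≠ 0 ∨ x₂ ≠ 0)
    (hy : y₁ ≠ 0 ∨ y₂ ≠ 0) (hxy : x₁ * y₂ - x₂ * y₁ = 0) (hu : x₁ * u₁ + x₂ * u₂ = 0)
    (hv : y₁ * v₁ + y₂ * v₂ = 0) : u₁ * v₂ - u₂ * v₁ = 0 := by
  have hv1 : x₁ * v₁ + x₂ * v₂ = 0 := by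
    rcases hy with h | h <;> apply mul_right_cancel₀ h
    · linear_combination x₁ * hv - v₂ * hxy
    · linear_combination x₂ * hv + v₁ * hxy
  rcases hx with h | h <;> apply mul_right_cancel₀ h
  · linear_combination v₂ * hu - u₂ * hv1
  · linear_combination u₁ * hv1 - v₁ * hu

/-- Two critical points of the distance to the origin at different distances are linearly
independent when the origin lies inside the ellipse and off its axes. -/
theorem linearIndependent_ellT_of_critical {a b : ℝ} (hb : 0 < b) (hba : b < a) {c : ℝ × ℝ}
    (hc : c.1 ^ 2 / a ^ 2 + c.2 ^ 2 / b ^ 2 < 1) (hc1 : c.1 ≠ 0) (hc2 : c.2 ≠ 0) {ξ η : ℝ}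
    (hne : ellTNormSq a b c ξ ≠ ellTNormSq a b c η)
    (hξ : deriv (ellTNormSq a b c) ξ = 0) (hη : deriv (ellTNormSq a b c) η = 0) :
    LinearIndependent ℝ ![ellT a b c ξ, ellT a b c η] := by
  have ha : 0 < a := hb.trans hba
  have hP := ellT_ne_zero ha hb hc ξ
  have hQ := ellT_ne_zero ha hb hc η
  rw [(hasDerivAt_ellTNormSq a b c _).deriv] at hξ hη
  apply linearIndependent_pair_of_det_ne_zero
  intro hdet
  simp only [ellT, ne_eq, Prod.ext_iff, Prod.fst_zero, Prod.snd_zero, not_and_or] at hP hQ hdet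
  have hpar := det_eq_zero_of_orthogonal hP hQ hdet
    ((mul_eq_zero.1 hξ).resolve_left two_ne_zero) ((mul_eq_zero.1 hη).resolve_left two_ne_zero)
  have hsin : Real.sin ξ * Real.cos η - Real.cos ξ * Real.sin η = 0 := by
    apply mul_left_cancel₀ (mul_pos ha hb).ne'
    linear_combination -hpar
  rw [← Real.sin_sub] at hsin
  have hξη : ξ = (ξ - η) + η := by ring
  rcases Real.sin_eq_zero_iff_cos_eq.1 hsin with hcos | hcos
  · refine hne ?_
    have e1 : Real.cos ξ = Real.cos η := by
      rw [hξη, Real.cos_add, hsin, hcos]; ring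
    have e2 : Real.sin ξ = Real.sin η := by
      rw [hξη, Real.sin_add, hsin, hcos]; ring
    simp only [ellTNormSq, e1, e2]
  · have e1 : Real.cos ξ = -Real.cos η := by
      rw [hξη, Real.cos_add, hsin, hcos]; ring
    have e2 : Real.sin ξ = -Real.sin η := by
      rw [hξη, Real.sin_add, hsin, hcos]; ring
    rw [e1, e2] at hdet
    have hcv : c.1 * (b * Real.sin η) - c.2 * (a * Real.cos η) = 0 := by linarith
    have hab : a ^ 2 - b ^ 2 ≠ 0 := by nlinarith
    have hsq := Real.sin_sq_add_cos_sq η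
    rw [e1, e2] at hξ
    have hrad : (a ^ 2 - b ^ 2) * (Real.sin η * Real.cos η) = 0 := by linarith
    rcases mul_eq_zero.1 ((mul_eq_zero.1 hrad).resolve_left hab) with h | h
    · rw [h] at hcv hsq
      have hk : Real.cos η ≠ 0 := by rintro hk; simp [hk] at hsq
      simp [hk, hc2, ha.ne'] at hcv
    · rw [h] at hcv hsq
      have hk : Real.sin η ≠ 0 := by rintro hk; simp [hk] at hsq
      simp [hk, hc1, hb.ne'] at hcv

/-- A fixed non-circular ellipse with semi-axes `a > b > 0` can be placed almost
everywhere with respect to the origin (keeping the origin in its interior) so as to give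
an admissible domain: for Lebesgue-a.e. translation vector `c` with
`c₁²/a² + c₂²/b² < 1`, there are two parameters `ξ₁, ξ₂ ∈ [0, 2π)` which are strict
local maxima or minima of `ξ ↦ |c + (a cos ξ, b sin ξ)|`, such that the segment from
the origin to each corresponding point meets the translated ellipse only at that point,
and the two points are linearly independent (non-antipodal central configurations). -/
theorem translated_ellipse_ae_admissible
    (a b : ℝ) (hb : 0 < b) (hba : b < a) :
    ∀ᵐ c : ℝ × ℝ ∂volume,
      c.1 ^ 2 / a ^ 2 + c.2 ^ 2 / b ^ 2 < 1 →
      ∃ ξ₁ ∈ Set.Ico (0 : ℝ) (2 * Real.pi), ∃ ξ₂ ∈ Set.Ico (0 : ℝ) (2 * Real.pi),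
        ((∃ δ > 0, ∀ η : ℝ, η ≠ ξ₁ → |η - ξ₁| < δ →
            enorm2 (ellT a b c η) < enorm2 (ellT a b c ξ₁)) ∨
         (∃ δ > 0, ∀ η : ℝ, η ≠ ξ₁ → |η - ξ₁| < δ →
            enorm2 (ellT a b c ξ₁) < enorm2 (ellT a b c η))) ∧
        ((∃ δ > 0, ∀ η : ℝ, η ≠ ξ₂ → |η - ξ₂| < δ →
            enorm2 (ellT a b c η) < enorm2 (ellT a b c ξ₂)) ∨
         (∃ δ > 0, ∀ η : ℝ, η ≠ ξ₂ → |η - ξ₂| < δ →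
            enorm2 (ellT a b c ξ₂) < enorm2 (ellT a b c η))) ∧
        (segment ℝ (0 : ℝ × ℝ) (ellT a b c ξ₁) ∩ Set.range (ellT a b c)
            = {ellT a b c ξ₁}) ∧
        (segment ℝ (0 : ℝ × ℝ) (ellT a b c ξ₂) ∩ Set.range (ellT a b c)
            = {ellT a b c ξ₂}) ∧
        LinearIndependent ℝ ![ellT a b c ξ₁, ellT a b c ξ₂] := by
  have ha : 0 < a := hb.trans hba
  have h0 : ∀ᵐ x : ℝ ∂volume, x ≠ 0 := compl_mem_ae_iff.2 (measure_singleton 0)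
  have hfst : ∀ᵐ c : ℝ × ℝ ∂volume, c.1 ≠ 0 := Measure.quasiMeasurePreserving_fst.ae h0
  have hsnd : ∀ᵐ c : ℝ × ℝ ∂volume, c.2 ≠ 0 := Measure.quasiMeasurePreserving_snd.ae h0
  filter_upwards [hfst, hsnd] with c hc1 hc2 hc
  have hf := analyticOnNhd_ellTNormSq a b c
  have hnc : ellTNormSq a b c 0 ≠ ellTNormSq a b c Real.pi := by
    intro h
    simp only [ellTNormSq, Real.cos_zero, Real.sin_zero, Real.cos_pi, Real.sin_pi] at h
    have : a * c.1 = 0 := by linarith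
    simp [ha.ne', hc1] at this
  obtain ⟨⟨ξ₁, hξ₁, hmax⟩, ξ₂, hξ₂, hmin⟩ :=
    (ellTNormSq_periodic a b c).exists_isMax_isMin Real.two_pi_pos
      (continuousOn_univ.1 hf.continuousOn)
  obtain ⟨δ₁, hδ₁, hstrict₁⟩ := hf.exists_forall_ne_of_not_const hnc ξ₁
  obtain ⟨δ₂, hδ₂, hstrict₂⟩ := hf.exists_forall_ne_of_not_const hnc ξ₂
  refine ⟨ξ₁, hξ₁, ξ₂, hξ₂, Or.inl ⟨δ₁, hδ₁, fun η hη hd => ?_⟩,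
    Or.inr ⟨δ₂, hδ₂, fun η hη hd => ?_⟩, segment_inter_range_ellT ha hb hc ξ₁,
    segment_inter_range_ellT ha hb hc ξ₂,
    linearIndependent_ellT_of_critical hb hba hc hc1 hc2 (fun h => hnc ?_)
      (IsLocalMax.deriv_eq_zero (Filter.Eventually.of_forall hmax))
      (IsLocalMin.deriv_eq_zero (Filter.Eventually.of_forall hmin))⟩
  · exact (enorm2_ellT_lt_iff a b c η ξ₁).2 (lt_of_le_of_ne (hmax η) (hstrict₁ η hη hd))
  · exact (enorm2_ellT_lt_iff a b c ξ₂ η).2 (lt_of_le_of_ne (hmin η) (hstrict₂ η hη hd).symm)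
  · linarith [hmax 0, hmin 0, hmax Real.pi, hmin Real.pi]
end
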